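/- Let 0 < α ≤ 1/2 and let ℐ be a closed ideal of 𝒜_α with ℐ ≠ {0}. Then there exists f ∈ ℐ, f ≢ 0, such that for every w ∈ 𝔻 the order of vanishing of f at w equals the minimum over g ∈ ℐ, g ≢ 0, of the order of vanishing of g at w; in particular the zeros of f in 𝔻, counted with multiplicity, are exactly the common zeros of ℐ in 𝔻. -/

import Mathlib

open Complex MeasureTheory Set Metric Filter
open scoped ENNReal Classical

noncomputable section

/-- The open unit disc in `ℂ`. -/
def uDisc : Set ℂ := Metric.ball 0 1

/-- The unit circle in `ℂ`. -/
def uCircle : Set ℂ := Metric.sphere (0 : ℂ) 1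

/-- `f` is analytic on the open unit disc and continuous on the closed unit disc. -/
def IsDiscReg (f : ℂ → ℂ) : Prop :=
  DifferentiableOn ℂ f uDisc ∧ ContinuousOn f (Metric.closedBall 0 1)

/-- The little-o Lipschitz condition of order `α` on the closed unit disc:
`|f z - f w| = o(|z-w|^α)` as `|z - w| → 0`. -/
def LittleLip (α : ℝ) (f : ℂ → ℂ) : Prop :=
  ∀ ε > 0, ∃ δ > 0, ∀ z ∈ Metric.closedBall (0 : ℂ) 1, ∀ w ∈ Metric.closedBall (0 : ℂ) 1,
    ‖z - w‖ < δ → ‖f z - f w‖ ≤ ε * ‖z - w‖ ^ α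

/-- Membership in `lip_α`. -/
def MemLip (α : ℝ) (f : ℂ → ℂ) : Prop := IsDiscReg f ∧ LittleLip α f

/-- The Dirichlet integral `D(f) = ∫_𝔻 |f'|² dA` with respect to the normalized
area measure `dA = (1/π)·(Lebesgue)`. -/
def dirInt (f : ℂ → ℂ) : ℝ := (1 / Real.pi) * ∫ z in uDisc, ‖deriv f z‖ ^ 2

/-- Membership in the Dirichlet space `𝒟`. -/
def MemDir (f : ℂ → ℂ) : Prop :=
  DifferentiableOn ℂ f uDisc ∧ IntegrableOn (fun z => ‖deriv f z‖ ^ 2) uDisc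

/-- Sup norm over the unit disc. -/
def supNorm (f : ℂ → ℂ) : ℝ := sSup ((fun z => ‖f z‖) '' uDisc)

/-- The `lip_α` norm `‖f‖_α = ‖f‖_∞ + sup_{z∈𝔻} (1-|z|)^{1-α}|f'(z)|`. -/
def lipNorm (α : ℝ) (f : ℂ → ℂ) : ℝ :=
  supNorm f + sSup ((fun z => (1 - ‖z‖) ^ (1 - α) * ‖deriv f z‖) '' uDisc)

/-- The `𝒜_α` norm `‖f‖_{𝒜_α} = ‖f‖_α + D(f)^{1/2}`. -/
def ANorm (α : ℝ) (f : ℂ → ℂ) : ℝ := lipNorm α f + Real.sqrt (dirInt f)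

/-- Membership in `𝒜_α = 𝒟 ∩ lip_α`. -/
def MemA (α : ℝ) (f : ℂ → ℂ) : Prop := MemDir f ∧ MemLip α f

/-- A closed ideal of the Banach algebra `𝒜_α`, encoded as a set of functions `ℂ → ℂ`
(two functions agreeing on the closed disc represent the same element of `𝒜_α`). -/
structure IsClosedIdeal (α : ℝ) (J : Set (ℂ → ℂ)) : Prop where
  mem_A : ∀ f ∈ J, MemA α f
  zero_mem : (0 : ℂ → ℂ) ∈ J
  add_mem : ∀ f ∈ J, ∀ g ∈ J, f + g ∈ J
  smul_mem : ∀ (c : ℂ), ∀ f ∈ J, c • f ∈ J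
  mul_mem : ∀ f ∈ J, ∀ g : ℂ → ℂ, MemA α g → f * g ∈ J
  ext_mem : ∀ f ∈ J, ∀ g : ℂ → ℂ, MemA α g →
    (∀ z ∈ Metric.closedBall (0 : ℂ) 1, g z = f z) → g ∈ J
  closed : ∀ (F : ℕ → ℂ → ℂ) (f : ℂ → ℂ), (∀ n, F n ∈ J) → MemA α f →
    Tendsto (fun n => ANorm α (F n - f)) atTop (nhds 0) → f ∈ J

/-- The boundary zero set `E_f = {ξ ∈ 𝕋 : f ξ = 0}`. -/
def bZeros (f : ℂ → ℂ) : Set ℂ := {ξ | ξ ∈ uCircle ∧ f ξ = 0}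

/-- An inner function: bounded analytic on `𝔻` with radial limits of modulus `1`
at almost every point of `𝕋`. -/
def IsInner (U : ℂ → ℂ) : Prop :=
  DifferentiableOn ℂ U uDisc ∧ (∀ z ∈ uDisc, ‖U z‖ ≤ 1) ∧
    ∀ᵐ θ : ℝ, Tendsto (fun r : ℝ => ‖U ((r : ℂ) * Complex.exp ((θ : ℂ) * Complex.I))‖)
      (nhdsWithin 1 (Set.Iio 1)) (nhds 1)

/-- The Schwarz/Herglotz kernel `(e^{iθ}+z)/(e^{iθ}-z)`. -/
def circleKernel (z : ℂ) (θ : ℝ) : ℂ :=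
  (Complex.exp ((θ : ℂ) * Complex.I) + z) / (Complex.exp ((θ : ℂ) * Complex.I) - z)

/-- `f` is an outer function. -/
def IsOuter (f : ℂ → ℂ) : Prop :=
  IsDiscReg f ∧ (∃ z ∈ uDisc, f z ≠ 0) ∧
    ∀ z ∈ uDisc, f z = Complex.exp ((1 / (2 * (Real.pi : ℂ))) *
      ∫ θ in (0:ℝ)..(2 * Real.pi),
        circleKernel z θ * (Real.log ‖f (Complex.exp ((θ : ℂ) * Complex.I))‖ : ℂ))

/-- The outer power `f^ρ`, the outer function with boundary modulus `|f|^ρ`. -/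
def outerPow (f : ℂ → ℂ) (ρ : ℝ) (z : ℂ) : ℂ :=
  Complex.exp (((ρ : ℂ) / (2 * (Real.pi : ℂ))) *
    ∫ θ in (0:ℝ)..(2 * Real.pi),
      circleKernel z θ * (Real.log ‖f (Complex.exp ((θ : ℂ) * Complex.I))‖ : ℂ))

/-- The set of angles in `[0, 2π)` whose corresponding point of the circle lies in `A`. -/
def angSet (A : Set ℂ) : Set ℝ :=
  {θ | θ ∈ Set.Ico (0 : ℝ) (2 * Real.pi) ∧ Complex.exp ((θ : ℂ) * Complex.I) ∈ A}

/-- The outer factor `f_Γ` associated with a boundary set `Γ ⊆ 𝕋`. -/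
def outerPart (f : ℂ → ℂ) (Γ : Set ℂ) (z : ℂ) : ℂ :=
  Complex.exp ((1 / (2 * (Real.pi : ℂ))) *
    ∫ θ in angSet Γ, circleKernel z θ * (Real.log ‖f (Complex.exp ((θ : ℂ) * Complex.I))‖ : ℂ))

/-- `𝕋 \ E_f`, the set of boundary points where `f` does not vanish. -/
def offZeros (f : ℂ → ℂ) : Set ℂ := {ξ | ξ ∈ uCircle ∧ f ξ ≠ 0}

/-- `γ` is a component arc (connected component) of `𝕋 \ E_f`. -/
def IsCompArc (f : ℂ → ℂ) (γ : Set ℂ) : Prop :=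
  ∃ x ∈ offZeros f, γ = connectedComponentIn (offZeros f) x

/-- `Γ` is a union of component arcs of `𝕋 \ E_f`. -/
def IsArcUnion (f : ℂ → ℂ) (Γ : Set ℂ) : Prop :=
  Γ ⊆ offZeros f ∧ ∀ x ∈ Γ, connectedComponentIn (offZeros f) x ⊆ Γ

/-- The sector `Δ_γ = {z ∈ 𝔻 : z/|z| ∈ γ}`. -/
def discSector (γ : Set ℂ) : Set ℂ := {z | z ∈ uDisc ∧ ((‖z‖ : ℂ))⁻¹ * z ∈ γ}

/-- Lower integral of `g` over `S` with respect to the normalized area measure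
`dA = (1/π)·(Lebesgue)`. -/
def nlint (S : Set ℂ) (g : ℂ → ℝ) : ℝ≥0∞ :=
  ENNReal.ofReal (1 / Real.pi) * ∫⁻ z in S, ENNReal.ofReal (g z)

/-- `d(z) = min(|z-a|, |z-b|)`, distance to the endpoints of the arc `γ = (a,b)`. -/
def dd (a b z : ℂ) : ℝ := min ‖z - a‖ ‖z - b‖

/-- `Λ_γ`: equals `Γ` if `γ ⊄ Γ`, and `𝕋 \ Γ` if `γ ⊆ Γ`. -/
def lamSet (Γ γ : Set ℂ) : Set ℂ := if γ ⊆ Γ then uCircle \ Γ else Γ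

/-- The function `a_γ(z) = (1/2π)∫_{Λ_γ} (−log|f(e^{iθ})|)/|e^{iθ}−z|² dθ`. -/
def aFun (f : ℂ → ℂ) (Γ γ : Set ℂ) (z : ℂ) : ℝ :=
  (1 / (2 * Real.pi)) * ∫ θ in angSet (lamSet Γ γ),
    (-(Real.log ‖f (Complex.exp ((θ : ℂ) * Complex.I))‖)) /
      ‖Complex.exp ((θ : ℂ) * Complex.I) - z‖ ^ 2

/-- `Δ_γ¹ = {z ∈ Δ_γ : d(z) < 2(1−|z|)}`. -/
def sector1 (a b : ℂ) (γ : Set ℂ) : Set ℂ :=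
  {z | z ∈ discSector γ ∧ dd a b z < 2 * (1 - ‖z‖)}

/-- `Δ_γ² = {z ∈ Δ_γ : d(z) ≥ 2(1−|z|)}`. -/
def sector2 (a b : ℂ) (γ : Set ℂ) : Set ℂ :=
  {z | z ∈ discSector γ ∧ 2 * (1 - ‖z‖) ≤ dd a b z}

/-- `Δ_γ²¹ = {z ∈ Δ_γ² : a_γ(z) ≤ 8|log d(z)|/d(z)}`. -/
def sector21 (f : ℂ → ℂ) (Γ γ : Set ℂ) (a b : ℂ) : Set ℂ :=
  {z | z ∈ sector2 a b γ ∧ aFun f Γ γ z ≤ 8 * |Real.log (dd a b z)| / dd a b z}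

/-- `Δ_γ²² = {z ∈ Δ_γ² : 8|log d(z)|/d(z) < a_γ(z) < 8|log d(z)|/(1−|z|)}`. -/
def sector22 (f : ℂ → ℂ) (Γ γ : Set ℂ) (a b : ℂ) : Set ℂ :=
  {z | z ∈ sector2 a b γ ∧ 8 * |Real.log (dd a b z)| / dd a b z < aFun f Γ γ z ∧
    aFun f Γ γ z < 8 * |Real.log (dd a b z)| / (1 - ‖z‖)}

/-- `Δ_γ²³ = {z ∈ Δ_γ² : a_γ(z) ≥ 8|log d(z)|/(1−|z|)}`. -/
def sector23 (f : ℂ → ℂ) (Γ γ : Set ℂ) (a b : ℂ) : Set ℂ :=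
  {z | z ∈ sector2 a b γ ∧ 8 * |Real.log (dd a b z)| / (1 - ‖z‖) ≤ aFun f Γ γ z}

/-- `μ_z = 1 − 8|log d(z)|/a_γ(z)`. -/
def muOf (f : ℂ → ℂ) (Γ γ : Set ℂ) (a b : ℂ) (z : ℂ) : ℝ :=
  1 - 8 * |Real.log (dd a b z)| / aFun f Γ γ z

/-- The tail union `Γ_m = ⋃_{p ≥ m} γ_p`. -/
def tailUnion (γ : ℕ → Set ℂ) (m : ℕ) : Set ℂ := ⋃ p ∈ Set.Ici m, γ p

end

/-- A Schwarz–Pick type bound for the derivative of a map into the closed unit disc. -/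
theorem norm_deriv_mul_le_of_norm_le_one {φ : ℂ → ℂ} {z : ℂ} {R : ℝ} (hR : 0 < R)
    (hd : DifferentiableOn ℂ φ (ball z R)) (hb : ∀ u ∈ ball z R, ‖φ u‖ ≤ 1) :
    ‖deriv φ z‖ * R ≤ 2 * (1 - ‖φ z‖) := by
  refine le_of_forall_pos_le_add fun ε hε => ?_
  obtain ⟨c, hc, hcz⟩ : ∃ c : ℂ, ‖c‖ = 1 ∧ c * φ z = ‖φ z‖ := by
    rcases eq_or_ne (φ z) 0 with h | h
    · exact ⟨1, by simp, by simp [h]⟩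
    · refine ⟨‖φ z‖ / φ z, by simp [h], by field_simp⟩
  set q : ℝ := 1 + ε / 2 - ‖φ z‖ with hq
  have hz : z ∈ ball z R := mem_ball_self hR
  have hq0 : 0 < q := by have := hb z hz; linarith
  set ψ : ℂ → ℂ := fun u => (1 + ε / 2 : ℝ) - c * φ u with hψ
  have hψre : ∀ u ∈ ball z R, 0 < (ψ u).re := fun u hu => by
    have h1 : (c * φ u).re ≤ 1 := (Complex.re_le_norm _).trans (by simp [hc, hb u hu])
    simp only [hψ, Complex.sub_re, Complex.ofReal_re]
    linarith
  have hψz : ψ z = q := by simp [hψ, hcz, hq]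
  have hne : ∀ u ∈ ball z R, ψ u + q ≠ 0 := fun u hu h => by
    have := congrArg Complex.re h
    have h2 := hψre u hu
    simp at this
    linarith
  have hψd : DifferentiableOn ℂ ψ (ball z R) := (hd.const_mul c).const_sub _
  have hT : DifferentiableOn ℂ (fun u => (ψ u - q) / (ψ u + q)) (ball z R) :=
    (hψd.sub_const _).div (hψd.add_const _) hne
  have hmaps : MapsTo (fun u => (ψ u - q) / (ψ u + q)) (ball z R)
      (ball ((fun u => (ψ u - q) / (ψ u + q)) z) 1) := fun u hu => by
    have h2 := hψre u hu
    simp only [hψz, sub_self, zero_div, mem_ball_zero_iff, norm_div]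
    rw [div_lt_one (norm_pos_iff.2 (hne u hu))]
    apply lt_of_pow_lt_pow_left₀ 2 (norm_nonneg _)
    rw [← Complex.normSq_eq_norm_sq, ← Complex.normSq_eq_norm_sq, Complex.normSq_apply,
      Complex.normSq_apply]
    simp only [Complex.sub_re, Complex.sub_im, Complex.add_re, Complex.add_im, Complex.ofReal_re,
      Complex.ofReal_im]
    nlinarith
  have key := Complex.norm_deriv_le_div_of_mapsTo_ball hT
    (hmaps.mono_right ball_subset_closedBall) hR
  have hφz : DifferentiableAt ℂ φ z := hd.differentiableAt (isOpen_ball.mem_nhds hz)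
  have hψ' : HasDerivAt ψ (-(c * deriv φ z)) z := (hφz.hasDerivAt.const_mul c).const_sub _
  have hder : deriv (fun u => (ψ u - q) / (ψ u + q)) z = -(c * deriv φ z) / (2 * q) := by
    have := ((hψ'.sub_const (q : ℂ)).div (hψ'.add_const (q : ℂ)) (hne z hz)).deriv
    rw [show (fun u => (ψ u - q) / (ψ u + q)) = (fun u => ψ u - q) / (fun u => ψ u + q) from rfl,
      this, hψz]
    have : (q : ℂ) ≠ 0 := by exact_mod_cast hq0.ne'
    field_simp
    ring
  rw [hder, norm_div, norm_neg, norm_mul, hc, one_mul, norm_mul, Complex.norm_real,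
    Real.norm_of_nonneg hq0.le, Complex.norm_two, div_le_div_iff₀ (by positivity) hR] at key
  rw [hq] at key
  linarith

/-- A growth bound on the derivative controls the modulus of continuity on the closed disc. -/
theorem norm_sub_le_of_deriv_growth {α ε C : ℝ} (hα0 : 0 < α) (hα1 : α ≤ 1) (hε : 0 ≤ ε)
    (hC : 0 ≤ C) {f : ℂ → ℂ} (hf : IsDiscReg f)
    (hb : ∀ z ∈ uDisc, ‖deriv f z‖ ≤ ε * (1 - ‖z‖) ^ (α - 1) + C)
    {z w : ℂ} (hz : z ∈ closedBall (0 : ℂ) 1) (hw : w ∈ closedBall (0 : ℂ) 1)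
    (hzw : ‖z - w‖ ≤ 1) :
    ‖f z - f w‖ ≤ ε * (2 / α + 1) * ‖z - w‖ ^ α + 3 * C * ‖z - w‖ := by
  rcases eq_or_ne z w with rfl | hne
  · simp [Real.zero_rpow hα0.ne']
  set t := ‖z - w‖ with ht
  have ht0 : 0 < t := norm_pos_iff.2 (sub_ne_zero.2 hne)
  have hdiff : ∀ u ∈ uDisc, DifferentiableAt ℂ f u := fun u hu =>
    hf.1.differentiableAt (isOpen_ball.mem_nhds hu)
  have radial : ∀ u ∈ closedBall (0 : ℂ) 1,
      ‖f u - f ((1 - t : ℝ) * u)‖ ≤ ε * (t ^ α / α) + C * t := fun u hu => by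
    have hu1 : ‖u‖ ≤ 1 := by simpa using hu
    have hg : ContinuousOn (fun s : ℝ => f ((1 - t + s : ℝ) * u) - f ((1 - t : ℝ) * u))
        (Icc 0 t) := by
      refine ContinuousOn.sub (hf.2.comp (by fun_prop) fun s hs => ?_) continuousOn_const
      simp only [mem_closedBall_zero_iff, norm_mul, Complex.norm_real]
      rw [Real.norm_of_nonneg (by linarith [hs.1])]
      exact mul_le_one₀ (by linarith [hs.2]) (norm_nonneg _) hu1
    have hin : ∀ s ∈ Ico 0 t, ‖((1 - t + s : ℝ) : ℂ) * u‖ ≤ 1 - (t - s) := fun s hs => by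
      rw [norm_mul, Complex.norm_real, Real.norm_of_nonneg (by linarith [hs.1])]
      have : (1 - t + s) * ‖u‖ ≤ (1 - t + s) * 1 :=
        mul_le_mul_of_nonneg_left hu1 (by linarith [hs.1])
      linarith
    have hin' : ∀ s ∈ Ico 0 t, ((1 - t + s : ℝ) : ℂ) * u ∈ uDisc := fun s hs =>
      mem_ball_zero_iff.2 ((hin s hs).trans_lt (by linarith [hs.2]))
    have := image_norm_le_of_norm_deriv_right_le_deriv_boundary' (a := 0) (b := t)
      (f := fun s : ℝ => f ((1 - t + s : ℝ) * u) - f ((1 - t : ℝ) * u))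
      (f' := fun s => deriv f ((1 - t + s : ℝ) * u) * u) hg
      (fun s hs => by
        have h1 : HasDerivAt (fun s : ℝ => ((1 - t + s : ℝ) : ℂ) * u) u s := by
          have := ((hasDerivAt_id s).const_add (1 - t)).ofReal_comp.mul_const u
          simpa using this
        have h2 := (hdiff _ (hin' s hs)).hasDerivAt
        exact ((h2.comp s h1).sub_const _).hasDerivWithinAt)
      (B := fun s => ε * ((t ^ α - (t - s) ^ α) / α) + C * s)
      (B' := fun s => ε * (t - s) ^ (α - 1) + C)
      (by simp)
      (by
        refine ContinuousOn.add (ContinuousOn.mul continuousOn_const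
          (ContinuousOn.div_const (ContinuousOn.sub continuousOn_const ?_) _)) (by fun_prop)
        exact ContinuousOn.rpow_const (by fun_prop) fun _ _ => Or.inr hα0.le)
      (fun s hs => by
        have h1 : HasDerivAt (fun s => (t - s) ^ α) (-1 * α * (t - s) ^ (α - 1)) s :=
          ((hasDerivAt_id s).const_sub t).rpow_const (Or.inl (by simp; linarith [hs.2]))
        have h2 := (((h1.const_sub (t ^ α)).div_const α).const_mul ε).add
          ((hasDerivAt_id s).const_mul C)
        exact (h2.congr_deriv (by field_simp)).hasDerivWithinAt)
      (fun s hs => by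
        rw [norm_mul]
        have h1 := hb _ (hin' s hs)
        have h2 : (1 - ‖((1 - t + s : ℝ) : ℂ) * u‖) ^ (α - 1) ≤ (t - s) ^ (α - 1) :=
          Real.rpow_le_rpow_of_nonpos (by linarith [hs.2]) (by linarith [hin s hs]) (by linarith)
        calc _ ≤ ‖deriv f ((1 - t + s : ℝ) * u)‖ * 1 := by gcongr
          _ ≤ _ := by rw [mul_one]; exact h1.trans (by gcongr))
      (x := t) ⟨ht0.le, le_rfl⟩
    simpa [Real.zero_rpow hα0.ne'] using this
  have middle : ‖f ((1 - t : ℝ) * z) - f ((1 - t : ℝ) * w)‖ ≤ (ε * t ^ (α - 1) + C) * t := by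
    have hmem : ∀ u ∈ closedBall (0 : ℂ) 1, ((1 - t : ℝ) : ℂ) * u ∈ closedBall (0 : ℂ) (1 - t) := by
      intro u hu
      rw [mem_closedBall_zero_iff] at hu ⊢
      rw [norm_mul, Complex.norm_real, Real.norm_of_nonneg (by linarith)]
      exact mul_le_of_le_one_right (by linarith) hu
    have hsub : closedBall (0 : ℂ) (1 - t) ⊆ uDisc := closedBall_subset_ball (by linarith)
    have := (convex_closedBall (0 : ℂ) (1 - t)).norm_image_sub_le_of_norm_deriv_le
      (f := f) (C := ε * t ^ (α - 1) + C) (fun u hu => hdiff u (hsub hu))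
      (fun u hu => (hb u (hsub hu)).trans (by
        have : t ≤ 1 - ‖u‖ := by
          rw [mem_closedBall_zero_iff] at hu; linarith
        have := Real.rpow_le_rpow_of_nonpos ht0 this (by linarith : α - 1 ≤ 0)
        gcongr)) (hmem w hw) (hmem z hz)
    refine this.trans ?_
    rw [← mul_sub, norm_mul, Complex.norm_real, Real.norm_of_nonneg (by linarith)]
    have h0 : 0 ≤ ε * t ^ (α - 1) + C := by positivity
    exact mul_le_mul_of_nonneg_left (mul_le_of_le_one_left ht0.le (by linarith)) h0
  have htt : t ^ (α - 1) * t = t ^ α := by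
    rw [Real.rpow_sub_one ht0.ne']; field_simp
  have h1 := radial z hz
  have h2 := radial w hw
  rw [norm_sub_rev] at h2
  calc ‖f z - f w‖ = ‖(f z - f ((1 - t : ℝ) * z)) + (f ((1 - t : ℝ) * z) - f ((1 - t : ℝ) * w))
        + (f ((1 - t : ℝ) * w) - f w)‖ := by congr 1; ring
    _ ≤ _ := norm_add₃_le
    _ ≤ (ε * (t ^ α / α) + C * t) + (ε * t ^ (α - 1) + C) * t + (ε * (t ^ α / α) + C * t) := by
        gcongr
    _ = ε * (2 / α) * t ^ α + ε * (t ^ (α - 1) * t) + 3 * C * t := by ring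
    _ = _ := by rw [htt]; ring

theorem IsDiscReg.exists_bound {f : ℂ → ℂ} (hf : IsDiscReg f) :
    ∃ M, 0 ≤ M ∧ ∀ z ∈ closedBall (0 : ℂ) 1, ‖f z‖ ≤ M := by
  obtain ⟨M, hM⟩ := (isCompact_closedBall (0 : ℂ) 1).exists_bound_of_continuousOn hf.2
  exact ⟨M, (norm_nonneg _).trans (hM 0 (by simp)), hM⟩

theorem IsDiscReg.diffContOnCl {f : ℂ → ℂ} (hf : IsDiscReg f) : DiffContOnCl ℂ f (ball 0 1) :=
  ⟨hf.1, by rw [closure_ball _ one_ne_zero]; exact hf.2⟩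

theorem half_norm_rpow_le_re_cpow {α : ℝ} (hα0 : 0 ≤ α) (hα1 : α ≤ 1 / 2) {s : ℂ}
    (hs : 0 < s.re) : ‖s‖ ^ α / 2 ≤ (s ^ (α : ℂ)).re := by
  have hs0 : s ≠ 0 := by rintro rfl; simp at hs
  have harg : |s.arg| ≤ Real.pi / 2 := Complex.abs_arg_le_pi_div_two_iff.2 hs.le
  have h1 : |s.arg * α| ≤ 1 := by
    rw [abs_mul, abs_of_nonneg hα0]
    nlinarith [Real.pi_le_four, abs_nonneg s.arg]
  have h2 := Real.one_sub_sq_div_two_le_cos (x := s.arg * α)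
  have h3 : (s.arg * α) ^ 2 ≤ 1 := by rw [← sq_abs]; exact pow_le_one₀ (abs_nonneg _) h1
  have h4 : 0 ≤ ‖s‖ ^ α := by positivity
  have h5 : 1 / 2 ≤ Real.cos (s.arg * α) := by linarith
  have h6 : (s ^ (α : ℂ)).re = ‖s‖ ^ α * Real.cos (s.arg * α) := by
    rw [Complex.cpow_ofReal, Complex.re_ofReal_mul]
    simp [-Complex.ofReal_cos, -Complex.ofReal_sin]
  rw [h6]
  nlinarith

/-- If `h` has the same boundary modulus as a little Lipschitz function `f` but is larger inside
the disc, then `h'` obeys a growth bound depending only on `f`. -/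
theorem exists_deriv_growth_of_littleLip {α : ℝ} (hα0 : 0 < α) (hα1 : α ≤ 1 / 2) {f : ℂ → ℂ}
    (hf : IsDiscReg f) (hl : LittleLip α f) {ε : ℝ} (hε : 0 < ε) :
    ∃ C, 0 ≤ C ∧ ∀ h : ℂ → ℂ, IsDiscReg h → (∀ z ∈ uDisc, ‖f z‖ ≤ ‖h z‖) →
      (∀ z ∈ sphere (0 : ℂ) 1, ‖h z‖ ≤ ‖f z‖) →
      ∀ z ∈ uDisc, ‖deriv h z‖ ≤ ε * (1 - ‖z‖) ^ (α - 1) + C := by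
  obtain ⟨M, hM0, hM⟩ := hf.exists_bound
  set η := ε / 10 with hη
  have hη0 : 0 < η := by positivity
  obtain ⟨δ, hδ0, hδ⟩ := hl η hη0
  set C := 4 * M / δ ^ 2 with hC
  have hC0 : 0 ≤ C := by positivity
  refine ⟨5 * C, by positivity, fun h hh hfh hhf z hz => ?_⟩
  have hz1 : ‖z‖ < 1 := mem_ball_zero_iff.1 hz
  set a := ‖f z‖ with ha
  have ha0 : 0 ≤ a := norm_nonneg _
  set s : ℂ → ℂ := fun ζ => 1 - (starRingEnd ℂ) z * ζ with hs
  have hsre : ∀ ζ ∈ closedBall (0 : ℂ) 1, 0 < (s ζ).re := fun ζ hζ => by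
    rw [mem_closedBall_zero_iff] at hζ
    have h1 : ((starRingEnd ℂ) z * ζ).re ≤ ‖z‖ * ‖ζ‖ := by
      simpa using Complex.re_le_norm ((starRingEnd ℂ) z * ζ)
    simp only [hs, Complex.sub_re, Complex.one_re]
    nlinarith [norm_nonneg z, norm_nonneg ζ]
  have hsre' : ∀ ζ ∈ closedBall (0 : ℂ) 1, ‖s ζ‖ ^ 2 / 2 ≤ (s ζ).re := fun ζ hζ => by
    rw [mem_closedBall_zero_iff] at hζ
    have h1 : ‖(starRingEnd ℂ) z * ζ‖ ≤ 1 := by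
      rw [norm_mul, RCLike.norm_conj]; exact mul_le_one₀ hz1.le (norm_nonneg _) hζ
    have h2 : ‖(starRingEnd ℂ) z * ζ‖ ^ 2 ≤ 1 := pow_le_one₀ (norm_nonneg _) h1
    rw [← Complex.normSq_eq_norm_sq, Complex.normSq_apply] at h2 ⊢
    simp only [hs, Complex.sub_re, Complex.one_re, Complex.sub_im, Complex.one_im]
    nlinarith
  set W : ℂ → ℂ := fun ζ => a + 2 * η * s ζ ^ (α : ℂ) + C * s ζ with hW
  have hWre : ∀ ζ ∈ closedBall (0 : ℂ) 1,
      a + η * ‖s ζ‖ ^ α + C * (‖s ζ‖ ^ 2 / 2) ≤ (W ζ).re := fun ζ hζ => by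
    have h1 := half_norm_rpow_le_re_cpow hα0.le hα1 (hsre ζ hζ)
    have h2 := hsre' ζ hζ
    have h3 : (W ζ).re = a + 2 * η * (s ζ ^ (α : ℂ)).re + C * (s ζ).re := by
      simp only [hW, Complex.add_re, Complex.ofReal_re, Complex.re_ofReal_mul]
      rw [show (2 * η * s ζ ^ (α : ℂ) : ℂ) = ((2 * η : ℝ) : ℂ) * s ζ ^ (α : ℂ) by push_cast; ring,
        Complex.re_ofReal_mul]
    rw [h3]
    have := mul_le_mul_of_nonneg_left h1 (by positivity : 0 ≤ 2 * η)
    have := mul_le_mul_of_nonneg_left h2 hC0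
    linarith
  have hs0 : ∀ ζ ∈ closedBall (0 : ℂ) 1, 0 < ‖s ζ‖ := fun ζ hζ =>
    norm_pos_iff.2 fun h => by have := hsre ζ hζ; simp [h] at this
  have hWpos : ∀ ζ ∈ closedBall (0 : ℂ) 1, 0 < (W ζ).re := fun ζ hζ => by
    have := hs0 ζ hζ
    exact lt_of_lt_of_le (by positivity) (hWre ζ hζ)
  have hW0 : ∀ ζ ∈ closedBall (0 : ℂ) 1, W ζ ≠ 0 := fun ζ hζ h => by
    have := hWpos ζ hζ; simp [h] at this
  have hsd : ∀ ζ, HasDerivAt s (-(starRingEnd ℂ) z) ζ := fun ζ => by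
    have := ((hasDerivAt_id ζ).const_mul ((starRingEnd ℂ) z)).const_sub 1
    simpa using this
  have hWd : ∀ ζ ∈ closedBall (0 : ℂ) 1,
      HasDerivAt W (2 * η * (α * s ζ ^ (α - 1 : ℂ) * (-(starRingEnd ℂ) z)) + C * (-(starRingEnd ℂ) z)) ζ :=
    fun ζ hζ => by
      have h1 := (hsd ζ).cpow_const (c := (α : ℂ)) (Or.inl (hsre ζ hζ))
      exact ((h1.const_mul (2 * η : ℂ)).const_add (a : ℂ)).add ((hsd ζ).const_mul (C : ℂ))
  set φ : ℂ → ℂ := fun ζ => h ζ / W ζ with hφ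
  have hsub : ball (0 : ℂ) 1 ⊆ closedBall 0 1 := ball_subset_closedBall
  have hφd : DiffContOnCl ℂ φ (ball 0 1) := by
    refine ⟨fun ζ hζ => ?_, ?_⟩
    · exact (hh.1 ζ hζ).div (hWd ζ (hsub hζ)).differentiableAt.differentiableWithinAt
        (hW0 ζ (hsub hζ))
    · rw [closure_ball _ one_ne_zero]
      exact hh.2.div (fun ζ hζ => (hWd ζ hζ).continuousAt.continuousWithinAt) hW0
  have hbdry : ∀ ζ ∈ frontier (ball (0 : ℂ) 1), ‖φ ζ‖ ≤ 1 := fun ζ hζ => by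
    rw [frontier_ball _ one_ne_zero] at hζ
    have hζ' : ζ ∈ closedBall (0 : ℂ) 1 := sphere_subset_closedBall hζ
    have hζ1 : ‖ζ‖ = 1 := by simpa using hζ
    rw [hφ, norm_div, div_le_one (norm_pos_iff.2 (hW0 ζ hζ'))]
    have hsn : ‖s ζ‖ = ‖ζ - z‖ := by
      have : s ζ = ζ * (starRingEnd ℂ) (ζ - z) := by
        have : ζ * (starRingEnd ℂ) ζ = 1 := by rw [Complex.mul_conj, Complex.normSq_eq_norm_sq, hζ1]; simp
        rw [map_sub, mul_sub, this]; simp only [hs]; ring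
      rw [this, norm_mul, hζ1, one_mul, RCLike.norm_conj]
    refine le_trans ?_ ((hWre ζ hζ').trans (Complex.re_le_norm _))
    have h1 : ‖f ζ‖ ≤ a + ‖f ζ - f z‖ := by
      have := norm_add_le (f z) (f ζ - f z); simpa [ha] using this
    refine (hhf ζ hζ).trans (h1.trans ?_)
    rw [hsn, add_assoc]
    gcongr
    rcases lt_or_ge ‖ζ - z‖ δ with hlt | hge
    · have := hδ ζ hζ' z (hsub hz) hlt
      have h2 : 0 ≤ C * (‖ζ - z‖ ^ 2 / 2) := by positivity
      linarith
    · have h2 : ‖f ζ - f z‖ ≤ 2 * M := by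
        have := norm_sub_le (f ζ) (f z)
        linarith [hM ζ hζ', hM z (hsub hz)]
      have h3 : C * (δ ^ 2 / 2) ≤ C * (‖ζ - z‖ ^ 2 / 2) := by gcongr
      have h4 : C * (δ ^ 2 / 2) = 2 * M := by rw [hC]; field_simp; ring
      have h5 : 0 ≤ η * ‖ζ - z‖ ^ α := by positivity
      linarith
  have hφ1 : ∀ ζ ∈ ball (0 : ℂ) 1, ‖φ ζ‖ ≤ 1 := fun ζ hζ =>
    Complex.norm_le_of_forall_mem_frontier_norm_le isBounded_ball hφd hbdry (subset_closure hζ)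
  set R := 1 - ‖z‖ with hR
  have hR0 : 0 < R := by linarith
  have hballs : ball z R ⊆ ball 0 1 := ball_subset_ball' (by simp [hR])
  have hSP := norm_deriv_mul_le_of_norm_le_one hR0 (hφd.1.mono hballs)
    fun u hu => hφ1 u (hballs hu)
  have hz' := hsub hz
  have hsz : s z = ((1 - ‖z‖ ^ 2 : ℝ) : ℂ) := by
    simp only [hs]; rw [mul_comm, Complex.mul_conj, Complex.normSq_eq_norm_sq]; push_cast; rfl
  set σ := 1 - ‖z‖ ^ 2 with hσ
  have hσR : R ≤ σ := by rw [hR, hσ]; nlinarith [norm_nonneg z]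
  have hσR' : σ ≤ 2 * R := by rw [hR, hσ]; nlinarith [norm_nonneg z]
  have hσ0 : 0 < σ := by linarith
  set τ := 2 * η * σ ^ α + C * σ with hτ
  have hτ0 : 0 < τ := by positivity
  have hWz : W z = ((a + τ : ℝ) : ℂ) := by
    simp only [hW, hsz, ← Complex.ofReal_cpow hσ0.le, hτ]; push_cast; ring
  have hWn : ‖W z‖ = a + τ := by
    rw [hWz, Complex.norm_real, Real.norm_of_nonneg (by positivity)]
  have hφz : 1 - ‖φ z‖ ≤ τ / (a + τ) := by
    have : a / (a + τ) ≤ ‖φ z‖ := by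
      rw [hφ, norm_div, hWn]; gcongr; exact hfh z hz
    have h2 : a / (a + τ) + τ / (a + τ) = 1 := by rw [← add_div, div_self (by positivity)]
    linarith
  have hWd' := hWd z hz'
  set w' := 2 * η * (α * s z ^ (α - 1 : ℂ) * (-(starRingEnd ℂ) z)) + C * (-(starRingEnd ℂ) z) with hw'
  have hw'n : ‖w'‖ ≤ 2 * η * R ^ (α - 1) + C := by
    have h1 : s z ^ (α - 1 : ℂ) = ((σ ^ (α - 1) : ℝ) : ℂ) := by
      rw [hsz, Complex.ofReal_cpow hσ0.le]; push_cast; rfl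
    have h2 : w' = ((2 * η * (α * σ ^ (α - 1)) + C : ℝ) : ℂ) * (-(starRingEnd ℂ) z) := by
      rw [hw', h1]; push_cast; ring
    rw [h2, norm_mul, norm_neg, RCLike.norm_conj, Complex.norm_real,
      Real.norm_of_nonneg (by positivity)]
    have h3 : σ ^ (α - 1) ≤ R ^ (α - 1) := Real.rpow_le_rpow_of_nonpos hR0 hσR (by linarith)
    calc _ ≤ (2 * η * (α * σ ^ (α - 1)) + C) * 1 := by gcongr
      _ ≤ (2 * η * (1 * R ^ (α - 1)) + C) * 1 := by gcongr; linarith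
      _ = _ := by ring
  have hφda : DifferentiableAt ℂ φ z := hφd.1.differentiableAt (isOpen_ball.mem_nhds hz)
  have hder : deriv h z = deriv φ z * W z + φ z * w' := by
    have heq : h =ᶠ[nhds z] fun ζ => φ ζ * W ζ := by
      filter_upwards [isOpen_ball.mem_nhds hz] with ζ hζ
      rw [hφ]; exact (div_mul_cancel₀ _ (hW0 ζ (hsub hζ))).symm
    rw [heq.deriv_eq]
    exact (hφda.hasDerivAt.mul hWd').deriv
  have hτR : τ ≤ (4 * η * R ^ (α - 1) + 2 * C) * R := by
    have h1 : σ ^ α ≤ 2 * (R ^ (α - 1) * R) := by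
      have e : R ^ (α - 1) * R = R ^ α := by rw [Real.rpow_sub_one hR0.ne']; field_simp
      rw [e]
      calc σ ^ α ≤ (2 * R) ^ α := Real.rpow_le_rpow hσ0.le hσR' hα0.le
        _ = 2 ^ α * R ^ α := Real.mul_rpow (by norm_num) hR0.le
        _ ≤ 2 ^ (1 : ℝ) * R ^ α := by
          gcongr
          · norm_num
          · linarith
        _ = _ := by rw [Real.rpow_one]
    calc τ ≤ 2 * η * (2 * (R ^ (α - 1) * R)) + C * (2 * R) := by rw [hτ]; gcongr
      _ = _ := by ring
  have h1 : ‖deriv φ z‖ * (a + τ) ≤ 2 * (4 * η * R ^ (α - 1) + 2 * C) := by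
    have h2 : ‖deriv φ z‖ * R ≤ 2 * (τ / (a + τ)) := by linarith
    have h3 : ‖deriv φ z‖ * R * (a + τ) ≤ 2 * τ := by
      calc _ ≤ 2 * (τ / (a + τ)) * (a + τ) := by gcongr
        _ = 2 * τ := by field_simp
    refine le_of_mul_le_mul_right (a := R) ?_ hR0
    linarith
  calc ‖deriv h z‖ ≤ ‖deriv φ z‖ * ‖W z‖ + ‖φ z‖ * ‖w'‖ := by
        rw [hder, ← norm_mul, ← norm_mul]; exact norm_add_le _ _
    _ ≤ 2 * (4 * η * R ^ (α - 1) + 2 * C) + 1 * (2 * η * R ^ (α - 1) + C) := by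
        rw [hWn]; gcongr; exact hφ1 z hz
    _ = ε * R ^ (α - 1) + 5 * C := by rw [hη]; ring

theorem littleLip_of_deriv_growth {α : ℝ} (hα0 : 0 < α) (hα1 : α < 1) {f : ℂ → ℂ}
    (hf : IsDiscReg f)
    (hb : ∀ ε > 0, ∃ C, 0 ≤ C ∧ ∀ z ∈ uDisc, ‖deriv f z‖ ≤ ε * (1 - ‖z‖) ^ (α - 1) + C) :
    LittleLip α f := by
  intro ε hε
  have hA : 0 < 2 / α + 1 := by positivity
  obtain ⟨C, hC, hfC⟩ := hb (ε / (2 * (2 / α + 1))) (by positivity)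
  have hcont : Tendsto (fun t : ℝ => 3 * C * t ^ (1 - α)) (nhds 0) (nhds 0) := by
    have := (Real.continuousAt_rpow_const 0 (1 - α) (Or.inr (by linarith))).const_mul (3 * C)
    simpa [ContinuousAt, Real.zero_rpow (by linarith : 1 - α ≠ 0)] using this
  obtain ⟨δ, hδ0, hδ⟩ := Metric.eventually_nhds_iff.1 (hcont.eventually_lt_const (half_pos hε))
  refine ⟨min δ 1, by positivity, fun z hz w hw hzw => ?_⟩
  have h1 := norm_sub_le_of_deriv_growth hα0 hα1.le (by positivity) hC hf hfC hz hw
    (hzw.le.trans (min_le_right _ _))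
  rcases (norm_nonneg (z - w)).eq_or_lt with h0 | h0
  · simpa [← h0, Real.zero_rpow hα0.ne'] using h1
  have h2 : 3 * C * ‖z - w‖ ^ (1 - α) < ε / 2 :=
    hδ (by simpa [abs_of_pos h0] using hzw.trans_le (min_le_left _ _))
  have h3 : 3 * C * ‖z - w‖ = 3 * C * ‖z - w‖ ^ (1 - α) * ‖z - w‖ ^ α := by
    rw [mul_assoc (3 * C), ← Real.rpow_add h0]; simp
  rw [h3] at h1
  refine h1.trans ?_
  have h4 : ε / (2 * (2 / α + 1)) * (2 / α + 1) = ε / 2 := by field_simp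
  rw [h4, ← add_mul]
  gcongr
  linarith

theorem MemA.exists_deriv_growth {α : ℝ} (hα0 : 0 < α) (hα1 : α ≤ 1 / 2) {f : ℂ → ℂ}
    (hf : MemA α f) {ε : ℝ} (hε : 0 < ε) :
    ∃ C, 0 ≤ C ∧ ∀ z ∈ uDisc, ‖deriv f z‖ ≤ ε * (1 - ‖z‖) ^ (α - 1) + C := by
  obtain ⟨C, hC, h⟩ := exists_deriv_growth_of_littleLip hα0 hα1 hf.2.1 hf.2.2 hε
  exact ⟨C, hC, h f hf.2.1 (fun _ _ => le_rfl) fun _ _ => le_rfl⟩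

theorem continuousOn_deriv_uDisc {f : ℂ → ℂ} (hf : DifferentiableOn ℂ f uDisc) :
    ContinuousOn (deriv f) uDisc :=
  (hf.deriv isOpen_ball).continuousOn

theorem measurableSet_uDisc : MeasurableSet uDisc := measurableSet_ball

theorem integrableOn_const_uDisc (c : ℝ) : IntegrableOn (fun _ : ℂ => c) uDisc :=
  integrableOn_const measure_ball_lt_top.ne

theorem IsDiscReg.dslope {f : ℂ → ℂ} (hf : IsDiscReg f) {w : ℂ} (hw : w ∈ uDisc) :
    IsDiscReg (dslope f w) := by
  have hn : uDisc ∈ nhds w := isOpen_ball.mem_nhds hw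
  refine ⟨(Complex.differentiableOn_dslope hn).2 hf.1, (continuousOn_dslope ?_).2
    ⟨hf.2, hf.1.differentiableAt hn⟩⟩
  exact mem_of_superset hn ball_subset_closedBall

theorem exists_norm_deriv_dslope_le {f : ℂ → ℂ} (hf : IsDiscReg f) {w : ℂ} (hw : w ∈ uDisc) :
    ∃ A B, 0 < A ∧ 0 ≤ B ∧ ∀ z ∈ uDisc, ‖deriv (dslope f w) z‖ ≤ A * ‖deriv f z‖ + B := by
  have hk := hf.dslope hw
  obtain ⟨M, hM0, hM⟩ := hk.exists_bound
  have hw1 : ‖w‖ < 1 := mem_ball_zero_iff.1 hw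
  set ρ := (1 - ‖w‖) / 2 with hρ
  have hρ0 : 0 < ρ := by linarith
  have hsub : closedBall w ρ ⊆ uDisc := closedBall_subset_ball' (by simp; linarith)
  obtain ⟨N, hN⟩ := (isCompact_closedBall w ρ).exists_bound_of_continuousOn
    ((continuousOn_deriv_uDisc hk.1).mono hsub)
  have hN0 : 0 ≤ N := (norm_nonneg _).trans (hN w (mem_closedBall_self hρ0.le))
  refine ⟨1 / ρ, N + M / ρ, by positivity, by positivity, fun z hz => ?_⟩
  rcases le_or_gt ‖z - w‖ ρ with h | h
  · have := hN z (by simpa [dist_eq_norm] using h)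
    have h2 : 0 ≤ 1 / ρ * ‖deriv f z‖ := by positivity
    have h3 : 0 ≤ M / ρ := by positivity
    linarith
  · have hzw : 0 < ‖z - w‖ := hρ0.trans h
    have hkd := hk.1.differentiableAt (isOpen_ball.mem_nhds hz)
    have hder : deriv f z = dslope f w z + (z - w) * deriv (dslope f w) z := by
      have h1 : f = fun u => (u - w) * dslope f w u + f w := by
        ext u; have := sub_smul_dslope f w u; simp only [smul_eq_mul] at this; rw [this]; ring
      have h2 := ((((hasDerivAt_id z).sub_const w).mul hkd.hasDerivAt).add_const (f w)).deriv
      have h3 : deriv f z = deriv (fun u => (u - w) * dslope f w u + f w) z :=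
        congrArg (fun g => deriv g z) h1
      rw [h3]
      refine (Eq.trans ?_ h2).trans ?_
      · rfl
      · simp
    have h1 : ‖z - w‖ * ‖deriv (dslope f w) z‖ ≤ ‖deriv f z‖ + M := by
      rw [← norm_mul, show (z - w) * deriv (dslope f w) z = deriv f z - dslope f w z by
        rw [hder]; ring]
      exact (norm_sub_le _ _).trans (by gcongr; exact hM z (ball_subset_closedBall hz))
    have h2 : ρ * ‖deriv (dslope f w) z‖ ≤ ‖deriv f z‖ + M :=
      (mul_le_mul_of_nonneg_right h.le (norm_nonneg _)).trans h1
    have h3 : ‖deriv (dslope f w) z‖ ≤ (‖deriv f z‖ + M) / ρ := by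
      rw [le_div_iff₀ hρ0]; linarith
    refine h3.trans ?_
    rw [add_div, div_eq_mul_one_div, mul_comm]
    linarith

theorem MemA.dslope {α : ℝ} (hα0 : 0 < α) (hα1 : α ≤ 1 / 2) {f : ℂ → ℂ} (hf : MemA α f) {w : ℂ}
    (hw : w ∈ uDisc) : MemA α (dslope f w) := by
  have hk := hf.2.1.dslope hw
  obtain ⟨A, B, hA, hB, hAB⟩ := exists_norm_deriv_dslope_le hf.2.1 hw
  refine ⟨⟨hk.1, ?_⟩, hk, littleLip_of_deriv_growth hα0 (by linarith) hk fun ε hε => ?_⟩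
  · refine Integrable.mono' ((hf.1.2.const_mul (2 * A ^ 2)).add
      (integrableOn_const_uDisc (2 * B ^ 2)))
      (((continuousOn_deriv_uDisc hk.1).norm.pow 2).aestronglyMeasurable measurableSet_uDisc) ?_
    refine (ae_restrict_iff' measurableSet_uDisc).2 (ae_of_all _ fun z hz => ?_)
    rw [Real.norm_of_nonneg (by positivity)]
    simp only [Pi.add_apply]
    calc _ ≤ (A * ‖deriv f z‖ + B) ^ 2 := by gcongr; exact hAB z hz
      _ ≤ _ := by nlinarith [sq_nonneg (A * ‖deriv f z‖ - B)]
  · obtain ⟨C, hC, hfC⟩ := hf.exists_deriv_growth hα0 hα1 (div_pos hε hA)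
    refine ⟨A * C + B, by positivity, fun z hz => (hAB z hz).trans ?_⟩
    have := mul_le_mul_of_nonneg_left (hfC z hz) hA.le
    have e : A * (ε / A * (1 - ‖z‖) ^ (α - 1) + C) = ε * (1 - ‖z‖) ^ (α - 1) + A * C := by
      field_simp
    linarith
theorem hasSum_sq_norm_of_summable {a : ℕ → ℂ} (ha : Summable fun n => ‖a n‖) :
    HasSum (fun n => ‖a n‖ ^ 2)
      ((1 / (2 * Real.pi)) *
        ∫ θ in -Real.pi..Real.pi, ‖∑' n : ℕ, a n * Complex.exp (θ * Complex.I) ^ n‖ ^ 2) := by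
  have : Fact (0 < 2 * Real.pi) := ⟨by positivity⟩
  have hs : Summable fun n : ℕ => a n • (fourier (n : ℤ) : C(AddCircle (2 * Real.pi), ℂ)) :=
    .of_norm (by simpa only [norm_smul, fourier_norm, mul_one] using ha)
  set g := ∑' n : ℕ, a n • (fourier (n : ℤ) : C(AddCircle (2 * Real.pi), ℂ)) with hg
  have hL := (ContinuousMap.toLp (E := ℂ) 2
    (AddCircle.haarAddCircle (T := 2 * Real.pi)) ℂ).hasSum hs.hasSum
  have hsq : Tendsto (fun N => ∑ n ∈ Finset.range N, ‖a n‖ ^ 2) atTop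
      (nhds (‖ContinuousMap.toLp (E := ℂ) 2
        (AddCircle.haarAddCircle (T := 2 * Real.pi)) ℂ g‖ ^ 2)) := by
    refine (hL.tendsto_sum_nat.norm.pow 2).congr fun N => ?_
    have ho : Orthonormal ℂ fun n : ℕ => fourierLp (T := 2 * Real.pi) 2 (n : ℤ) :=
      orthonormal_fourier.comp _ Nat.cast_injective
    have h1 := ho.inner_sum a a (Finset.range N)
    have h2 : ∑ n ∈ Finset.range N, ContinuousMap.toLp (E := ℂ) 2
        (AddCircle.haarAddCircle (T := 2 * Real.pi)) ℂ (a n • fourier (n : ℤ)) =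
        ∑ n ∈ Finset.range N, a n • fourierLp (T := 2 * Real.pi) 2 (n : ℤ) :=
      Finset.sum_congr rfl fun n _ => map_smul _ _ _
    rw [h2]
    rw [inner_self_eq_norm_sq_to_K] at h1
    have h3 : ∀ n, (starRingEnd ℂ) (a n) * a n = ((‖a n‖ ^ 2 : ℝ) : ℂ) := fun n => by
      rw [mul_comm, Complex.mul_conj, Complex.normSq_eq_norm_sq]
    simp only [h3] at h1
    have h4 : ((‖∑ n ∈ Finset.range N, a n • fourierLp (T := 2 * Real.pi) 2 (n : ℤ)‖ ^ 2 : ℝ) : ℂ)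
      = ((∑ n ∈ Finset.range N, ‖a n‖ ^ 2 : ℝ) : ℂ) := by push_cast; push_cast at h1; exact h1
    exact Complex.ofReal_injective h4
  have hI : ‖ContinuousMap.toLp (E := ℂ) 2
        (AddCircle.haarAddCircle (T := 2 * Real.pi)) ℂ g‖ ^ 2 = (1 / (2 * Real.pi)) *
        ∫ θ in -Real.pi..Real.pi, ‖∑' n : ℕ, a n * Complex.exp (θ * Complex.I) ^ n‖ ^ 2 := by
    have h1 : ‖ContinuousMap.toLp (E := ℂ) 2 (AddCircle.haarAddCircle (T := 2 * Real.pi)) ℂ g‖ ^ 2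
        = ∫ t, ‖g t‖ ^ 2 ∂(AddCircle.haarAddCircle (T := 2 * Real.pi)) := by
      have h := ContinuousMap.inner_toLp (𝕜 := ℂ) (AddCircle.haarAddCircle (T := 2 * Real.pi)) g g
      rw [inner_self_eq_norm_sq_to_K] at h
      apply Complex.ofReal_injective
      rw [← integral_complex_ofReal]
      push_cast
      refine h.trans (integral_congr_ae (ae_of_all _ fun t => ?_))
      simp [Complex.mul_conj, Complex.normSq_eq_norm_sq]
    have h2 := AddCircle.intervalIntegral_preimage (2 * Real.pi) (-Real.pi)
      (fun t => ‖g t‖ ^ 2)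
    rw [h1, AddCircle.integral_haarAddCircle, ← h2, smul_eq_mul, one_div]
    congr 1
    have h3 : -Real.pi + 2 * Real.pi = Real.pi := by ring
    rw [h3]
    refine intervalIntegral.integral_congr fun θ _ => ?_
    have h4 : g (θ : AddCircle (2 * Real.pi)) =
        ∑' n : ℕ, a n * Complex.exp (θ * Complex.I) ^ n := by
      rw [hg, ← ContinuousMap.tsum_apply hs]
      refine tsum_congr fun n => ?_
      rw [ContinuousMap.smul_apply, fourier_coe_apply, smul_eq_mul, ← Complex.exp_nat_mul]
      congr 2
      have := Real.pi_ne_zero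
      push_cast
      field_simp
    simp only [h4]
  rw [← hI]
  exact (hasSum_iff_tendsto_nat_of_nonneg (fun _ => by positivity) _).2 hsq
theorem lintegral_sq_norm_uDisc {φ : ℂ → ℂ} {c : ℕ → ℂ} (hφ : ContinuousOn φ uDisc)
    (h : ∀ z ∈ uDisc, HasSum (fun n => c n * z ^ n) (φ z)) :
    ∫⁻ z in uDisc, ENNReal.ofReal (‖φ z‖ ^ 2) =
      ∑' n : ℕ, ENNReal.ofReal (Real.pi * ‖c n‖ ^ 2 / (n + 1)) := by
  have hmeas : Measurable (uDisc.indicator fun z => ENNReal.ofReal (‖φ z‖ ^ 2)) := by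
    rw [← piecewise_eq_indicator]
    exact ContinuousOn.measurable_piecewise
      (ENNReal.continuous_ofReal.comp_continuousOn (hφ.norm.pow 2)) continuousOn_const
      measurableSet_uDisc
  have hcirc : ∀ r ∈ Ioo (0 : ℝ) 1,
      ∫⁻ θ in Ioo (-Real.pi) Real.pi, ENNReal.ofReal r *
        ENNReal.ofReal (‖φ (r * Complex.exp (θ * Complex.I))‖ ^ 2) =
      ∑' n : ℕ, ENNReal.ofReal (2 * Real.pi * ‖c n‖ ^ 2) * ENNReal.ofReal (r ^ (2 * n + 1)) := by
    intro r hr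
    have hmem : ∀ θ : ℝ, (r : ℂ) * Complex.exp (θ * Complex.I) ∈ uDisc := fun θ => by
      simp [uDisc, abs_of_pos hr.1, Complex.norm_exp_ofReal_mul_I, hr.2]
    have hs : Summable fun n => ‖c n * (r : ℂ) ^ n‖ := by
      have hr' : (r : ℂ) ∈ uDisc := by simp [uDisc, abs_of_pos hr.1, hr.2]
      exact (h r hr').summable.norm
    have hcont : Continuous fun θ : ℝ => ‖φ (r * Complex.exp (θ * Complex.I))‖ ^ 2 :=
      ((hφ.comp_continuous (by fun_prop) hmem).norm).pow 2
    have hP := hasSum_sq_norm_of_summable hs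
    have hval : ∀ θ : ℝ, ∑' n : ℕ, c n * (r : ℂ) ^ n * Complex.exp (θ * Complex.I) ^ n =
        φ (r * Complex.exp (θ * Complex.I)) := fun θ => by
      rw [← (h _ (hmem θ)).tsum_eq]
      exact tsum_congr fun n => by rw [mul_pow, mul_assoc]
    simp only [hval] at hP
    rw [lintegral_const_mul' _ _ ENNReal.ofReal_ne_top,
      ← ofReal_integral_eq_lintegral_ofReal (hcont.integrableOn_Icc.mono_set Ioo_subset_Icc_self)
        (ae_of_all _ fun _ => by positivity), ← integral_Ioc_eq_integral_Ioo,
      ← intervalIntegral.integral_of_le (by linarith [Real.pi_pos]), ← ENNReal.ofReal_mul hr.1.le]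
    have hP2 := hP.mul_left (2 * Real.pi * r)
    have e : 2 * Real.pi * r * (1 / (2 * Real.pi) * ∫ θ in -Real.pi..Real.pi,
        ‖φ (r * Complex.exp (θ * Complex.I))‖ ^ 2) =
        r * ∫ θ in -Real.pi..Real.pi, ‖φ (r * Complex.exp (θ * Complex.I))‖ ^ 2 := by
      have := Real.pi_ne_zero
      rw [← mul_assoc]
      congr 1
      field_simp
    rw [e] at hP2
    rw [← hP2.tsum_eq, ENNReal.ofReal_tsum_of_nonneg _ hP2.summable]
    · refine tsum_congr fun n => ?_
      rw [← ENNReal.ofReal_mul (by positivity)]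
      congr 1
      rw [norm_mul, norm_pow, Complex.norm_real, Real.norm_of_nonneg hr.1.le]
      ring
    · intro n; have := hr.1; positivity
  have hrad : ∀ n : ℕ, ∫⁻ r in Ioo (0 : ℝ) 1, ENNReal.ofReal (r ^ (2 * n + 1)) =
      ENNReal.ofReal (1 / (2 * n + 2)) := fun n => by
    rw [← ofReal_integral_eq_lintegral_ofReal
        ((continuous_pow _).integrableOn_Icc.mono_set Ioo_subset_Icc_self)
        ((ae_restrict_iff' measurableSet_Ioo).2 (ae_of_all _ fun r hr => pow_nonneg hr.1.le _)),
      ← integral_Ioc_eq_integral_Ioo, ← intervalIntegral.integral_of_le zero_le_one, integral_pow]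
    congr 1
    push_cast
    simp
    ring
  rw [← lintegral_indicator measurableSet_uDisc, ← Complex.lintegral_comp_polarCoord_symm]
  have hm2 : Measurable fun p : ℝ × ℝ => ENNReal.ofReal p.1 •
      uDisc.indicator (fun z => ENNReal.ofReal (‖φ z‖ ^ 2)) (Complex.polarCoord.symm p) := by
    have h1 : Measurable fun p : ℝ × ℝ => Complex.polarCoord.symm p := by
      simp only [Complex.polarCoord_symm_apply]
      fun_prop
    exact (ENNReal.measurable_ofReal.comp measurable_fst).mul (hmeas.comp h1)
  rw [polarCoord_target, Measure.volume_eq_prod, setLIntegral_prod _ hm2.aemeasurable]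
  have hin : ∀ r ∈ Ioi (0 : ℝ), ∫⁻ θ in Ioo (-Real.pi) Real.pi, ENNReal.ofReal r •
      uDisc.indicator (fun z => ENNReal.ofReal (‖φ z‖ ^ 2)) (Complex.polarCoord.symm (r, θ)) =
      (Ioo (0 : ℝ) 1).indicator (fun r => ∑' n : ℕ, ENNReal.ofReal (2 * Real.pi * ‖c n‖ ^ 2) *
        ENNReal.ofReal (r ^ (2 * n + 1))) r := by
    intro r hr
    have hr0 : 0 < r := hr
    have hexp : ∀ θ : ℝ, Complex.polarCoord.symm (r, θ) = r * Complex.exp (θ * Complex.I) :=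
      fun θ => by simp [Complex.exp_mul_I]
    by_cases h1 : r < 1
    · rw [indicator_of_mem (show r ∈ Ioo (0 : ℝ) 1 from ⟨hr0, h1⟩), ← hcirc r ⟨hr0, h1⟩]
      refine lintegral_congr fun θ => ?_
      rw [hexp, indicator_of_mem, smul_eq_mul]
      simp [uDisc, abs_of_pos hr0, Complex.norm_exp_ofReal_mul_I, h1]
    · rw [indicator_of_notMem (fun h => h1 h.2)]
      refine (lintegral_congr fun θ => ?_).trans lintegral_zero
      rw [hexp, indicator_of_notMem, smul_zero]
      simp [uDisc, abs_of_pos hr0, Complex.norm_exp_ofReal_mul_I, not_lt.1 h1]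
  rw [setLIntegral_congr_fun measurableSet_Ioi hin, lintegral_indicator measurableSet_Ioo,
    Measure.restrict_restrict measurableSet_Ioo, inter_eq_left.2 (fun x hx => hx.1),
    lintegral_tsum (fun n => by fun_prop)]
  refine tsum_congr fun n => ?_
  rw [lintegral_const_mul' _ _ ENNReal.ofReal_ne_top, hrad, ← ENNReal.ofReal_mul (by positivity)]
  congr 1
  field_simp
theorem lintegral_sq_norm_deriv_le_id_mul {k : ℂ → ℂ} (hk : DifferentiableOn ℂ k uDisc) :
    ∫⁻ z in uDisc, ENNReal.ofReal (‖deriv k z‖ ^ 2) ≤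
      ∫⁻ z in uDisc, ENNReal.ofReal (‖k z + z * deriv k z‖ ^ 2) := by
  set a : ℕ → ℂ := fun n => (n.factorial : ℂ)⁻¹ * iteratedDeriv n k 0 with ha_def
  have hk' := continuousOn_deriv_uDisc hk
  have ha : ∀ z ∈ uDisc, HasSum (fun n => a n * z ^ n) (k z) := fun z hz => by
    have := Complex.hasSum_taylorSeries_on_ball hk hz
    simp only [sub_zero, smul_eq_mul] at this
    exact this.congr_fun fun n => by ring
  have hder : ∀ z ∈ uDisc, HasSum (fun n : ℕ => (n + 1) * a (n + 1) * z ^ n) (deriv k z) := by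
    intro z hz
    have := Complex.hasSum_taylorSeries_on_ball (hk.deriv isOpen_ball) hz
    simp only [sub_zero, smul_eq_mul] at this
    refine this.congr_fun fun n => ?_
    have h0 : ((n : ℂ) + 1) ≠ 0 := by exact_mod_cast n.succ_ne_zero
    simp only [ha_def, ← iteratedDeriv_succ', Nat.factorial_succ]
    push_cast
    field_simp
  have hzk : ∀ z ∈ uDisc, HasSum (fun n : ℕ => (n + 1) * a n * z ^ n) (k z + z * deriv k z) := by
    intro z hz
    have h1 : HasSum (fun n : ℕ => n * a n * z ^ n) (z * deriv k z) := by
      rw [← hasSum_nat_add_iff' 1]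
      simpa using ((hder z hz).mul_left z).congr_fun fun n => by ring
    exact ((ha z hz).add h1).congr_fun fun n => by ring
  have hzk' : ContinuousOn (fun z => k z + z * deriv k z) uDisc :=
    hk.continuousOn.add (continuousOn_id.mul hk')
  rw [lintegral_sq_norm_uDisc hk' hder, lintegral_sq_norm_uDisc hzk' hzk]
  conv_rhs => rw [tsum_eq_zero_add' ENNReal.summable]
  refine le_trans (ENNReal.tsum_le_tsum fun n => ENNReal.ofReal_le_ofReal ?_) le_add_self
  have h1 : ‖(n : ℂ) + 1‖ = n + 1 := by exact_mod_cast Complex.norm_natCast (n + 1)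
  have h2 : ‖((n + 1 : ℕ) : ℂ) + 1‖ = n + 2 := by
    have := Complex.norm_natCast (n + 2); push_cast at this ⊢; rw [add_assoc]; norm_num [this]
  rw [norm_mul _ (a (n + 1)), norm_mul _ (a (n + 1)), h1, h2]
  push_cast
  rw [div_le_div_iff₀ (by positivity) (by positivity)]
  have h3 : 0 ≤ Real.pi * ‖a (n + 1)‖ ^ 2 := by positivity
  have h4 : (0 : ℝ) ≤ n := n.cast_nonneg
  nlinarith [mul_nonneg h3 h4, mul_nonneg h3 (mul_nonneg h4 h4)]

theorem hasDerivAt_of_uDisc {f : ℂ → ℂ} (hf : DifferentiableOn ℂ f uDisc) {z : ℂ} (hz : z ∈ uDisc) :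
    HasDerivAt f (deriv f z) z :=
  (hf.differentiableAt (isOpen_ball.mem_nhds hz)).hasDerivAt

/-- Replacing the factor `z - w` by `c (1 - conj w z)` does not increase the Dirichlet integral. -/
theorem MemA.setIntegral_swap_le {α : ℝ} (hα0 : 0 < α) (hα1 : α ≤ 1 / 2) {f : ℂ → ℂ}
    (hf : MemA α f) {w c : ℂ} (hw : w ∈ uDisc) (hfw : f w = 0) (hc : ‖c‖ = 1) :
    ∫ z in uDisc, ‖deriv (c • ((1 - ‖w‖ ^ 2 : ℂ) • _root_.dslope f w -
      (starRingEnd ℂ) w • f)) z‖ ^ 2 ≤ ∫ z in uDisc, ‖deriv f z‖ ^ 2 := by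
  have hkA := hf.dslope hα0 hα1 hw
  set k := _root_.dslope f w with hk
  have hkd := hkA.1.1
  have hw1 : ‖w‖ < 1 := mem_ball_zero_iff.1 hw
  have hcont := continuousOn_deriv_uDisc hkd
  obtain ⟨M, hM0, hM⟩ := hkA.2.1.exists_bound
  have hfd : ∀ z ∈ uDisc, deriv f z = k z + (z - w) * deriv k z := fun z hz => by
    have h1 : f = fun u => (u - w) * k u := by
      ext u; exact (sub_smul_dslope_of_zero hfw u).symm
    have h2 := ((((hasDerivAt_id z).sub_const w).mul (hasDerivAt_of_uDisc hkd hz))).deriv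
    have h3 : deriv f z = deriv (fun u => (u - w) * k u) z := congrArg (fun g => deriv g z) h1
    rw [h3]
    refine (Eq.trans ?_ h2).trans (by simp)
    rfl
  have hhd : ∀ z ∈ uDisc, deriv (c • ((1 - ‖w‖ ^ 2 : ℂ) • k - (starRingEnd ℂ) w • f)) z =
      c * ((1 - (starRingEnd ℂ) w * z) * deriv k z - (starRingEnd ℂ) w * k z) := fun z hz => by
    have h1 := ((((hasDerivAt_of_uDisc hkd hz).const_smul (1 - ‖w‖ ^ 2 : ℂ)).sub
      ((hasDerivAt_of_uDisc hf.1.1 hz).const_smul ((starRingEnd ℂ) w))).const_smul c).deriv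
    rw [h1, hfd z hz]
    simp only [smul_eq_mul]
    have : (‖w‖ : ℂ) ^ 2 = (starRingEnd ℂ) w * w := (Complex.conj_mul' w).symm
    rw [this]
    ring
  have hid : ∀ z ∈ uDisc, ‖deriv f z‖ ^ 2 -
      ‖deriv (c • ((1 - ‖w‖ ^ 2 : ℂ) • k - (starRingEnd ℂ) w • f)) z‖ ^ 2 =
      (1 - ‖w‖ ^ 2) * (‖k z + z * deriv k z‖ ^ 2 - ‖deriv k z‖ ^ 2) := fun z hz => by
    rw [hfd z hz, hhd z hz, norm_mul, hc, one_mul]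
    simp only [← Complex.normSq_eq_norm_sq, Complex.normSq_apply, Complex.add_re, Complex.add_im,
      Complex.sub_re, Complex.sub_im, Complex.mul_re, Complex.mul_im, Complex.conj_re,
      Complex.conj_im, Complex.one_re, Complex.one_im]
    ring
  have hi1 : IntegrableOn (fun z => ‖k z + z * deriv k z‖ ^ 2) uDisc := by
    refine Integrable.mono' ((hkA.1.2.const_mul 2).add (integrableOn_const_uDisc (2 * M ^ 2)))
      (((hkd.continuousOn.add (continuousOn_id.mul hcont)).norm.pow 2).aestronglyMeasurable
        measurableSet_uDisc) ?_
    refine (ae_restrict_iff' measurableSet_uDisc).2 (ae_of_all _ fun z hz => ?_)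
    rw [Real.norm_of_nonneg (by positivity)]
    simp only [Pi.add_apply]
    have hz1 : ‖z‖ ≤ 1 := (mem_ball_zero_iff.1 hz).le
    have h1 : ‖k z + z * deriv k z‖ ≤ M + ‖deriv k z‖ := by
      refine (norm_add_le _ _).trans (add_le_add (hM z (ball_subset_closedBall hz)) ?_)
      rw [norm_mul]
      exact mul_le_of_le_one_left (norm_nonneg _) hz1
    calc _ ≤ (M + ‖deriv k z‖) ^ 2 := by gcongr
      _ ≤ _ := by nlinarith [sq_nonneg (M - ‖deriv k z‖)]
  have hle : ∫ z in uDisc, ‖deriv k z‖ ^ 2 ≤ ∫ z in uDisc, ‖k z + z * deriv k z‖ ^ 2 := by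
    rw [integral_eq_lintegral_of_nonneg_ae (ae_of_all _ fun _ => by positivity)
      hkA.1.2.aestronglyMeasurable, integral_eq_lintegral_of_nonneg_ae
      (ae_of_all _ fun _ => by positivity) hi1.aestronglyMeasurable]
    exact ENNReal.toReal_mono hi1.lintegral_lt_top.ne (lintegral_sq_norm_deriv_le_id_mul hkd)
  have h0 : ∫ z in uDisc, ‖deriv (c • ((1 - ‖w‖ ^ 2 : ℂ) • k - (starRingEnd ℂ) w • f)) z‖ ^ 2 =
      ∫ z in uDisc, (‖deriv f z‖ ^ 2 -
        (1 - ‖w‖ ^ 2) * (‖k z + z * deriv k z‖ ^ 2 - ‖deriv k z‖ ^ 2)) :=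
    setIntegral_congr_fun measurableSet_uDisc fun z hz => by
      simp only [← hid z hz]; ring
  have hi2 : IntegrableOn (fun z => ‖k z + z * deriv k z‖ ^ 2 - ‖deriv k z‖ ^ 2) uDisc :=
    hi1.sub hkA.1.2
  rw [h0, integral_sub hf.1.2 (hi2.const_mul _), integral_const_mul, integral_sub hi1 hkA.1.2]
  have : 0 ≤ 1 - ‖w‖ ^ 2 := by nlinarith [norm_nonneg w]
  nlinarith

theorem analyticAt_of_uDisc {f : ℂ → ℂ} (hf : DifferentiableOn ℂ f uDisc) {w : ℂ}
    (hw : w ∈ uDisc) : AnalyticAt ℂ f w :=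
  hf.analyticAt (isOpen_ball.mem_nhds hw)

theorem analyticOrderAt_dslope_add_one {f : ℂ → ℂ} (hf : DifferentiableOn ℂ f uDisc) {w : ℂ}
    (hw : w ∈ uDisc) (hfw : f w = 0) :
    analyticOrderAt f w = 1 + analyticOrderAt (dslope f w) w := by
  have hk : DifferentiableOn ℂ (dslope f w) uDisc :=
    (Complex.differentiableOn_dslope (isOpen_ball.mem_nhds hw)).2 hf
  have h1 : f = (fun u => u - w) * dslope f w := by
    ext u; exact (sub_smul_dslope_of_zero hfw u).symm
  conv_lhs => rw [h1]
  rw [analyticOrderAt_mul (by fun_prop) (analyticAt_of_uDisc hk hw)]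
  congr 1
  exact analyticOrderAt_id_sub_const_self

theorem MemA.exists_eq_pow_mul {α : ℝ} (hα0 : 0 < α) (hα1 : α ≤ 1 / 2) {w : ℂ} (hw : w ∈ uDisc)
    (m : ℕ) {g : ℂ → ℂ} (hg : MemA α g) (hm : m ≤ analyticOrderAt g w) :
    ∃ u, MemA α u ∧ ∀ z, g z = (z - w) ^ m * u z := by
  induction m generalizing g with
  | zero => exact ⟨g, hg, by simp⟩
  | succ m ih =>
    have hgw : g w = 0 := by
      refine apply_eq_zero_of_analyticOrderAt_ne_zero fun h => ?_
      rw [h] at hm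
      simp at hm
    have hm' : (m : ℕ∞) ≤ analyticOrderAt (_root_.dslope g w) w := by
      rw [analyticOrderAt_dslope_add_one hg.1.1 hw hgw, Nat.cast_succ, add_comm] at hm
      exact (ENat.add_le_add_iff_left ENat.one_ne_top).1 hm
    obtain ⟨u, hu, h⟩ := ih (hg.dslope hα0 hα1 hw) hm'
    refine ⟨u, hu, fun z => ?_⟩
    have h2 := sub_smul_dslope_of_zero hgw z
    rw [← h2, h z, smul_eq_mul]
    ring

theorem IsClosedIdeal.dslope_mem {α : ℝ} (hα0 : 0 < α) (hα1 : α ≤ 1 / 2) {J : Set (ℂ → ℂ)}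
    (hJ : IsClosedIdeal α J) {f g : ℂ → ℂ} (hf : f ∈ J) (hg : g ∈ J) {w : ℂ} (hw : w ∈ uDisc)
    (hlt : analyticOrderAt g w < analyticOrderAt f w) : dslope f w ∈ J := by
  obtain ⟨m, hm⟩ := ENat.ne_top_iff_exists.1 hlt.ne_top
  obtain ⟨u, hu, hgu⟩ := (hJ.mem_A g hg).exists_eq_pow_mul hα0 hα1 hw m hm.le
  have hfA := hJ.mem_A f hf
  have hfw : f w = 0 := apply_eq_zero_of_analyticOrderAt_ne_zero (pos_of_gt hlt).ne'
  have huw : u w ≠ 0 := fun huw => by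
    have h1 : ((m + 1 : ℕ) : ℕ∞) ≤ analyticOrderAt g w := by
      refine (natCast_le_analyticOrderAt (analyticAt_of_uDisc (hJ.mem_A g hg).1.1 hw)).2
        ⟨dslope u w, analyticAt_of_uDisc (hu.dslope hα0 hα1 hw).1.1 hw, .of_forall fun z => ?_⟩
      rw [hgu z, ← sub_smul_dslope_of_zero huw z]
      simp only [smul_eq_mul]
      ring
    rw [← hm] at h1
    exact absurd (Nat.cast_le.1 h1) (by omega)
  have hk := hfA.dslope hα0 hα1 hw
  have hmk : (m : ℕ∞) ≤ analyticOrderAt (dslope f w) w := by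
    rw [analyticOrderAt_dslope_add_one hfA.1.1 hw hfw, ← hm] at hlt
    have := Order.add_one_le_of_lt hlt
    rw [add_comm] at this
    exact (ENat.add_le_add_iff_left ENat.one_ne_top).1 this
  obtain ⟨k, hkA, hfk⟩ := hk.exists_eq_pow_mul hα0 hα1 hw m hmk
  have key : dslope f w = (u w)⁻¹ • (g * k + (-1 : ℂ) • (f * dslope u w)) := by
    ext z
    have h1 := sub_smul_dslope_of_zero hfw z
    have h2 := sub_smul_dslope u w z
    simp only [smul_eq_mul] at h1 h2
    simp only [Pi.smul_apply, Pi.add_apply, Pi.mul_apply, smul_eq_mul]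
    rw [eq_inv_mul_iff_mul_eq₀ huw, hgu z]
    conv_rhs => rw [← h1]
    have h3 : u w = u z - (z - w) * dslope u w z := by rw [h2]; ring
    rw [h3, hfk z]
    ring
  rw [key]
  exact hJ.smul_mem _ _ (hJ.add_mem _ (hJ.mul_mem _ hg _ hkA) _
    (hJ.smul_mem _ _ (hJ.mul_mem _ hf _ (hu.dslope hα0 hα1 hw))))

/-- Near-minimizers of a quadratic functional on a decreasing sequence of convex sets are Cauchy,
by the parallelogram identity. -/
theorem exists_seq_le_of_parallelogram {X : Type*} [AddCommGroup X] [Module ℝ X] {T : ℕ → Set X}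
    (hT : Antitone T) (hconv : ∀ n, Convex ℝ (T n)) {q : X → ℝ} (hq : ∀ x, 0 ≤ q x) {D : ℝ}
    (hD : ∀ n, ∃ x ∈ T n, q x ≤ D) {r : X → X → ℝ}
    (hr : ∀ x ∈ T 0, ∀ y ∈ T 0, r x y + 4 * q (midpoint ℝ x y) = 2 * q x + 2 * q y) :
    ∃ u : ℕ → X, (∀ n, u n ∈ T n) ∧
      ∃ s : ℕ → ℝ, Tendsto s atTop (nhds 0) ∧ ∀ n m, n ≤ m → r (u n) (u m) ≤ s n := by
  set d : ℕ → ℝ := fun n => sInf (q '' T n) with hd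
  have hbdd : ∀ n, BddBelow (q '' T n) := fun n => ⟨0, by rintro _ ⟨x, -, rfl⟩; exact hq x⟩
  have hne : ∀ n, (q '' T n).Nonempty := fun n => by
    obtain ⟨x, hx, -⟩ := hD n; exact ⟨_, x, hx, rfl⟩
  have hdle : ∀ n, ∀ x ∈ T n, d n ≤ q x := fun n x hx => csInf_le (hbdd n) ⟨x, hx, rfl⟩
  have hdmono : Monotone d := fun n m h => csInf_le_csInf (hbdd n) (hne m) (image_mono (hT h))
  have hdbdd : BddAbove (range d) := ⟨D, by
    rintro _ ⟨n, rfl⟩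
    obtain ⟨x, hx, hxD⟩ := hD n
    exact (hdle n x hx).trans hxD⟩
  have hlim := tendsto_atTop_ciSup hdmono hdbdd
  have hu : ∀ n : ℕ, ∃ x ∈ T n, q x < d n + 1 / ((n : ℝ) + 1) := fun n => by
    obtain ⟨_, ⟨x, hx, rfl⟩, h⟩ := exists_lt_of_csInf_lt (hne n)
      (lt_add_of_pos_right (d n) (Nat.one_div_pos_of_nat (n := n)))
    exact ⟨x, hx, h⟩
  choose u huT huq using hu
  refine ⟨u, huT, fun n => 2 * ((⨆ i, d i) - d n) + 4 * (1 / ((n : ℝ) + 1)), ?_, ?_⟩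
  · have h1 := ((tendsto_const_nhds (x := ⨆ i, d i)).sub hlim).const_mul 2
    have h2 := (tendsto_one_div_add_atTop_nhds_zero_nat (𝕜 := ℝ)).const_mul 4
    simpa using h1.add h2
  · intro n m hnm
    have h1 := hr _ (hT (Nat.zero_le n) (huT n)) _ (hT (Nat.zero_le m) (huT m))
    have h2 := hdle n _ ((hconv n).midpoint_mem (huT n) (hT hnm (huT m)))
    have h3 := le_ciSup hdbdd m
    have h4 : 1 / ((m : ℝ) + 1) ≤ 1 / ((n : ℝ) + 1) := Nat.one_div_le_one_div hnm
    have h5 := huq n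
    have h6 := huq m
    linarith

theorem MemDir.add {f g : ℂ → ℂ} (hf : MemDir f) (hg : MemDir g) : MemDir (f + g) := by
  refine ⟨hf.1.add hg.1, Integrable.mono' ((hf.2.const_mul 2).add (hg.2.const_mul 2))
    (((continuousOn_deriv_uDisc (hf.1.add hg.1)).norm.pow 2).aestronglyMeasurable
      measurableSet_uDisc) ?_⟩
  refine (ae_restrict_iff' measurableSet_uDisc).2 (ae_of_all _ fun z hz => ?_)
  rw [Real.norm_of_nonneg (by positivity),
    ((hasDerivAt_of_uDisc hf.1 hz).add (hasDerivAt_of_uDisc hg.1 hz)).deriv]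
  simp only [Pi.add_apply]
  calc _ ≤ (‖deriv f z‖ + ‖deriv g z‖) ^ 2 := by gcongr; exact norm_add_le _ _
    _ ≤ _ := by nlinarith [sq_nonneg (‖deriv f z‖ - ‖deriv g z‖)]

theorem MemDir.const_smul {f : ℂ → ℂ} (hf : MemDir f) (c : ℂ) : MemDir (c • f) := by
  refine ⟨hf.1.const_smul c, IntegrableOn.congr_fun (f := fun z => ‖c‖ ^ 2 * ‖deriv f z‖ ^ 2)
    (hf.2.const_mul (‖c‖ ^ 2)) (fun z hz => ?_) measurableSet_uDisc⟩
  have : deriv (c • f) z = c • deriv f z := ((hasDerivAt_of_uDisc hf.1 hz).const_smul c).deriv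
  simp only [this, norm_smul, mul_pow]

theorem MemDir.sub {f g : ℂ → ℂ} (hf : MemDir f) (hg : MemDir g) : MemDir (f - g) := by
  have := hf.add (hg.const_smul (-1))
  rwa [neg_one_smul, ← sub_eq_add_neg] at this

theorem MemDir.parallelogram {f g : ℂ → ℂ} (hf : MemDir f) (hg : MemDir g) :
    (∫ z in uDisc, ‖deriv (f - g) z‖ ^ 2) + 4 * ∫ z in uDisc, ‖deriv (midpoint ℝ f g) z‖ ^ 2 =
      2 * (∫ z in uDisc, ‖deriv f z‖ ^ 2) + 2 * ∫ z in uDisc, ‖deriv g z‖ ^ 2 := by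
  have hm : midpoint ℝ f g = (2⁻¹ : ℂ) • (f + g) := by
    ext z
    simp [midpoint_eq_smul_add, mul_add]
  have hmd : MemDir (midpoint ℝ f g) := by rw [hm]; exact (hf.add hg).const_smul _
  rw [← integral_const_mul, ← integral_const_mul, ← integral_const_mul,
    ← integral_add (hf.sub hg).2 (hmd.2.const_mul 4),
    ← integral_add (hf.2.const_mul 2) (hg.2.const_mul 2)]
  refine setIntegral_congr_fun measurableSet_uDisc fun z hz => ?_
  have hfz := hasDerivAt_of_uDisc hf.1 hz
  have hgz := hasDerivAt_of_uDisc hg.1 hz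
  have h1 : deriv (midpoint ℝ f g) z = (2⁻¹ : ℂ) • (deriv f z + deriv g z) := by
    rw [hm]; exact ((hfz.add hgz).const_smul _).deriv
  have h2 : deriv (f - g) z = deriv f z - deriv g z := (hfz.sub hgz).deriv
  have h3 := parallelogram_law_with_norm ℝ (deriv f z) (deriv g z)
  have h4 : ‖(2⁻¹ : ℂ)‖ = 2⁻¹ := by norm_num
  simp only [h1, h2, norm_smul, mul_pow, h4]
  nlinarith

theorem IsDiscReg.sub {f g : ℂ → ℂ} (hf : IsDiscReg f) (hg : IsDiscReg g) : IsDiscReg (f - g) :=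
  ⟨hf.1.sub hg.1, hf.2.sub hg.2⟩

theorem setIntegral_sq_le_of_tendsto {g : ℕ → ℂ → ℂ} {h : ℂ → ℂ} {D : ℝ}
    (hg : ∀ n, IntegrableOn (fun z => ‖g n z‖ ^ 2) uDisc)
    (hD : ∀ᶠ n in atTop, ∫ z in uDisc, ‖g n z‖ ^ 2 ≤ D)
    (hh : ContinuousOn h uDisc)
    (hlim : ∀ z ∈ uDisc, Tendsto (fun n => g n z) atTop (nhds (h z))) :
    IntegrableOn (fun z => ‖h z‖ ^ 2) uDisc ∧ ∫ z in uDisc, ‖h z‖ ^ 2 ≤ D := by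
  have hms : AEStronglyMeasurable (fun z => ‖h z‖ ^ 2) (volume.restrict uDisc) :=
    (hh.norm.pow 2).aestronglyMeasurable measurableSet_uDisc
  obtain ⟨n₀, hn₀⟩ := hD.exists
  have hD0 : 0 ≤ D := (integral_nonneg fun _ => by positivity).trans hn₀
  have hle : ∫⁻ z in uDisc, ENNReal.ofReal (‖h z‖ ^ 2) ≤ ENNReal.ofReal D := by
    have h1 : ∫⁻ z in uDisc, ENNReal.ofReal (‖h z‖ ^ 2) =
        ∫⁻ z in uDisc, liminf (fun n => ENNReal.ofReal (‖g n z‖ ^ 2)) atTop :=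
      setLIntegral_congr_fun measurableSet_uDisc fun z hz => by
        exact (((ENNReal.continuous_ofReal.tendsto _).comp
          ((hlim z hz).norm.pow 2)).liminf_eq).symm
    rw [h1]
    refine (lintegral_liminf_le' fun n => (hg n).aestronglyMeasurable.aemeasurable.ennreal_ofReal).trans
      (liminf_le_of_frequently_le' (hD.mono fun n hn => ?_).frequently)
    rw [← ofReal_integral_eq_lintegral_ofReal (hg n) (ae_of_all _ fun _ => by positivity)]
    exact ENNReal.ofReal_le_ofReal hn
  have hfin : IntegrableOn (fun z => ‖h z‖ ^ 2) uDisc := by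
    refine ⟨hms, ?_⟩
    rw [hasFiniteIntegral_iff_ofReal (ae_of_all _ fun _ => by positivity)]
    exact hle.trans_lt ENNReal.ofReal_lt_top
  refine ⟨hfin, ?_⟩
  rw [← ofReal_integral_eq_lintegral_ofReal hfin (ae_of_all _ fun _ => by positivity)] at hle
  exact (ENNReal.ofReal_le_ofReal_iff hD0).1 hle

/-- Uniform growth of the derivatives and uniform convergence give convergence in `lip_α`. -/
theorem tendsto_lipNorm_sub {α : ℝ} (hα1 : α < 1) {h : ℕ → ℂ → ℂ}
    {F : ℂ → ℂ} (hh : ∀ n, IsDiscReg (h n)) (hF : IsDiscReg F)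
    (hg : ∀ ε > 0, ∃ C, 0 ≤ C ∧ ∀ n, ∀ z ∈ uDisc, ‖deriv (h n) z‖ ≤ ε * (1 - ‖z‖) ^ (α - 1) + C)
    (hFg : ∀ ε > 0, ∃ C, 0 ≤ C ∧ ∀ z ∈ uDisc, ‖deriv F z‖ ≤ ε * (1 - ‖z‖) ^ (α - 1) + C)
    (hlim : TendstoUniformlyOn h F atTop (closedBall 0 1)) :
    Tendsto (fun n => lipNorm α (h n - F)) atTop (nhds 0) := by
  have h0 : (uDisc : Set ℂ).Nonempty := ⟨0, by simp [uDisc]⟩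
  have hnn : ∀ n, 0 ≤ lipNorm α (h n - F) := fun n => by
    refine add_nonneg (Real.sSup_nonneg ?_) (Real.sSup_nonneg ?_)
    · rintro _ ⟨z, -, rfl⟩; positivity
    · rintro _ ⟨z, hz, rfl⟩
      have : 0 ≤ 1 - ‖z‖ := by have := mem_ball_zero_iff.1 hz; linarith
      positivity
  suffices H : ∀ ε > 0, ∀ᶠ n in atTop, lipNorm α (h n - F) ≤ 4 * ε by
    refine Metric.tendsto_nhds.2 fun ε hε => (H (ε / 8) (by positivity)).mono fun n hn => ?_
    rw [dist_zero_right, Real.norm_of_nonneg (hnn n)]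
    linarith
  intro ε hε
  obtain ⟨C₁, hC₁, h1⟩ := hg ε hε
  obtain ⟨C₂, hC₂, h2⟩ := hFg ε hε
  have hcont : Tendsto (fun t : ℝ => (C₁ + C₂) * t ^ (1 - α)) (nhds 0) (nhds 0) := by
    have := (Real.continuousAt_rpow_const 0 (1 - α) (Or.inr (by linarith))).const_mul (C₁ + C₂)
    simpa [ContinuousAt, Real.zero_rpow (by linarith : 1 - α ≠ 0)] using this
  obtain ⟨δ, hδ0, hδ⟩ := Metric.eventually_nhds_iff.1 (hcont.eventually_lt_const hε)
  have hη : 0 < min ε (ε * δ / 2) := by positivity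
  filter_upwards [Metric.tendstoUniformlyOn_iff.1 hlim _ hη] with n hn
  have hn' : ∀ z ∈ closedBall (0 : ℂ) 1, ‖h n z - F z‖ ≤ min ε (ε * δ / 2) := fun z hz => by
    have := (hn z hz).le
    rwa [dist_comm, dist_eq_norm] at this
  have hs : supNorm (h n - F) ≤ ε := by
    refine csSup_le (h0.image _) ?_
    rintro _ ⟨z, hz, rfl⟩
    exact (hn' z (ball_subset_closedBall hz)).trans (min_le_left _ _)
  have hd : sSup ((fun z => (1 - ‖z‖) ^ (1 - α) * ‖deriv (h n - F) z‖) '' uDisc) ≤ 3 * ε := by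
    refine csSup_le (h0.image _) ?_
    rintro _ ⟨z, hz, rfl⟩
    have hz1 : ‖z‖ < 1 := mem_ball_zero_iff.1 hz
    have ht0 : 0 < 1 - ‖z‖ := by linarith
    have ht1 : 1 - ‖z‖ ≤ 1 := by linarith [norm_nonneg z]
    simp only
    rcases lt_or_ge (1 - ‖z‖) δ with ht | ht
    · have e : deriv (h n - F) z = deriv (h n) z - deriv F z :=
        ((hasDerivAt_of_uDisc (hh n).1 hz).sub (hasDerivAt_of_uDisc hF.1 hz)).deriv
      have h3 : ‖deriv (h n - F) z‖ ≤ 2 * ε * (1 - ‖z‖) ^ (α - 1) + (C₁ + C₂) := by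
        rw [e]
        have := norm_sub_le (deriv (h n) z) (deriv F z)
        linarith [h1 n z hz, h2 z hz]
      have h4 : (1 - ‖z‖) ^ (1 - α) * (1 - ‖z‖) ^ (α - 1) = 1 := by
        rw [← Real.rpow_add ht0]; simp
      have h5 : (C₁ + C₂) * (1 - ‖z‖) ^ (1 - α) < ε :=
        hδ (by simpa [abs_of_pos ht0] using ht)
      have h6 := mul_le_mul_of_nonneg_left h3 (Real.rpow_nonneg ht0.le (1 - α))
      nlinarith
    · have h3 : ‖deriv (h n - F) z‖ ≤ ε * δ / 2 / (δ / 2) := by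
        refine Complex.norm_deriv_le_of_forall_mem_sphere_norm_le (by positivity) ?_ fun u hu => ?_
        · refine DifferentiableOn.diffContOnCl ?_
          rw [closure_ball _ (by positivity)]
          refine ((hh n).sub hF).1.mono (closedBall_subset_ball' ?_)
          rw [dist_zero_right]; linarith
        · refine (hn' u ?_).trans (min_le_right _ _)
          have : ‖u - z‖ = δ / 2 := by simpa [dist_eq_norm] using hu
          have := norm_sub_norm_le u z
          rw [mem_closedBall_zero_iff]
          linarith
      have h4 : ε * δ / 2 / (δ / 2) = ε := by field_simp
      rw [h4] at h3
      have h5 : (1 - ‖z‖) ^ (1 - α) ≤ 1 := Real.rpow_le_one ht0.le ht1 (by linarith)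
      have := mul_le_mul h5 h3 (norm_nonneg _) zero_le_one
      linarith
  unfold lipNorm
  linarith

theorem isDiscReg_of_tendstoUniformlyOn {h : ℕ → ℂ → ℂ} {F : ℂ → ℂ} (hh : ∀ n, IsDiscReg (h n))
    (hlim : TendstoUniformlyOn h F atTop (closedBall 0 1)) : IsDiscReg F :=
  ⟨((hlim.mono ball_subset_closedBall).tendstoLocallyUniformlyOn).differentiableOn
    (.of_forall fun n => (hh n).1) isOpen_ball,
    hlim.continuousOn (Frequently.of_forall fun n => (hh n).2)⟩

theorem tendsto_deriv_of_tendstoUniformlyOn {h : ℕ → ℂ → ℂ} {F : ℂ → ℂ}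
    (hh : ∀ n, IsDiscReg (h n)) (hlim : TendstoUniformlyOn h F atTop (closedBall 0 1))
    {z : ℂ} (hz : z ∈ uDisc) : Tendsto (fun n => deriv (h n) z) atTop (nhds (deriv F z)) :=
  (((hlim.mono ball_subset_closedBall).tendstoLocallyUniformlyOn).deriv
    (.of_forall fun n => (hh n).1) isOpen_ball).tendsto_at hz

/-- A closed ideal contains the uniform limits of its sequences whose derivatives grow uniformly
slowly and which have bounded Dirichlet integrals. -/
theorem IsClosedIdeal.mem_of_tendstoUniformlyOn {α : ℝ} (hα0 : 0 < α) (hα1 : α < 1)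
    {J : Set (ℂ → ℂ)} (hJ : IsClosedIdeal α J) {f : ℕ → ℂ → ℂ} {F : ℂ → ℂ} (hf : ∀ n, f n ∈ J)
    (hg : ∀ ε > 0, ∃ C, 0 ≤ C ∧ ∀ n, ∀ z ∈ uDisc, ‖deriv (f n) z‖ ≤ ε * (1 - ‖z‖) ^ (α - 1) + C)
    {D : ℝ} (hD : ∀ n, ∫ z in uDisc, ‖deriv (f n) z‖ ^ 2 ≤ D)
    (hlim : TendstoUniformlyOn f F atTop (closedBall 0 1)) : F ∈ J := by
  have hfr : ∀ n, IsDiscReg (f n) := fun n => (hJ.mem_A _ (hf n)).2.1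
  have hF : IsDiscReg F := isDiscReg_of_tendstoUniformlyOn hfr hlim
  have hFg : ∀ ε > 0, ∃ C, 0 ≤ C ∧ ∀ z ∈ uDisc, ‖deriv F z‖ ≤ ε * (1 - ‖z‖) ^ (α - 1) + C :=
    fun ε hε => by
      obtain ⟨C, hC, h⟩ := hg ε hε
      exact ⟨C, hC, fun z hz => le_of_tendsto (tendsto_deriv_of_tendstoUniformlyOn hfr hlim hz).norm
        (.of_forall fun n => h n z hz)⟩
  have hFA : MemA α F := ⟨⟨hF.1, (setIntegral_sq_le_of_tendsto
    (fun n => (hJ.mem_A _ (hf n)).1.2) (.of_forall hD) (continuousOn_deriv_uDisc hF.1)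
    fun z hz => tendsto_deriv_of_tendstoUniformlyOn hfr hlim hz).1⟩, hF,
    littleLip_of_deriv_growth hα0 hα1 hF hFg⟩
  choose! C hC0 hC using hg
  set K : Set (ℂ → ℂ) := {h | h ∈ J ∧ ∀ ε > 0, ∀ z ∈ uDisc,
    ‖deriv h z‖ ≤ ε * (1 - ‖z‖) ^ (α - 1) + C ε} with hK
  have hKconv : Convex ℝ K := by
    intro u hu v hv a b ha hb hab
    have e : a • u + b • v = (a : ℂ) • u + (b : ℂ) • v := by ext z; simp
    refine ⟨?_, fun ε hε z hz => ?_⟩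
    · rw [e]
      exact hJ.add_mem _ (hJ.smul_mem _ _ hu.1) _ (hJ.smul_mem _ _ hv.1)
    · have hd : deriv (a • u + b • v) z = a • deriv u z + b • deriv v z :=
        (((hasDerivAt_of_uDisc (hJ.mem_A _ hu.1).1.1 hz).const_smul a).add
          ((hasDerivAt_of_uDisc (hJ.mem_A _ hv.1).1.1 hz).const_smul b)).deriv
      rw [hd]
      exact mem_closedBall_zero_iff.1 (convex_closedBall (0 : ℂ) _
        (mem_closedBall_zero_iff.2 (hu.2 ε hε z hz)) (mem_closedBall_zero_iff.2 (hv.2 ε hε z hz))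
        ha hb hab)
  set T : ℕ → Set (ℂ → ℂ) := fun n => convexHull ℝ (f '' Ici n) with hT
  have hTK : ∀ n, T n ⊆ K := fun n => convexHull_min (by
    rintro _ ⟨m, -, rfl⟩
    exact ⟨hf m, fun ε hε => hC ε hε m⟩) hKconv
  have hKD : ∀ h ∈ K, MemDir h := fun h hh => (hJ.mem_A _ hh.1).1
  obtain ⟨u, huT, s, hs, hus⟩ := exists_seq_le_of_parallelogram (T := T)
    (fun n m hnm => convexHull_mono (image_mono (Ici_subset_Ici.2 hnm)))
    (fun n => convex_convexHull ℝ _) (q := fun h => ∫ z in uDisc, ‖deriv h z‖ ^ 2)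
    (fun h => integral_nonneg fun _ => by positivity)
    (fun n => ⟨f n, subset_convexHull ℝ _ ⟨n, mem_Ici.2 le_rfl, rfl⟩, hD n⟩)
    (r := fun x y => ∫ z in uDisc, ‖deriv (x - y) z‖ ^ 2)
    (fun x hx y hy => (hKD x (hTK 0 hx)).parallelogram (hKD y (hTK 0 hy)))
  have huK : ∀ n, u n ∈ K := fun n => hTK n (huT n)
  have hur : ∀ n, IsDiscReg (u n) := fun n => (hJ.mem_A _ (huK n).1).2.1
  have hulim : TendstoUniformlyOn u F atTop (closedBall 0 1) := by
    refine Metric.tendstoUniformlyOn_iff.2 fun ε hε => ?_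
    obtain ⟨N, hN⟩ := eventually_atTop.1 (Metric.tendstoUniformlyOn_iff.1 hlim ε hε)
    refine eventually_atTop.2 ⟨N, fun n hn z hz => ?_⟩
    have hsub : T n ⊆ {h : ℂ → ℂ | h z ∈ ball (F z) ε} := by
      refine convexHull_min ?_ ((convex_ball (F z) ε).is_linear_preimage (f := fun h : ℂ → ℂ => h z)
        ⟨fun _ _ => rfl, fun _ _ => rfl⟩)
      rintro _ ⟨m, hm, rfl⟩
      exact mem_ball'.2 (hN m (hn.trans hm) z hz)
    exact mem_ball'.1 (hsub (huT n))
  have hlip : Tendsto (fun n => lipNorm α (u n - F)) atTop (nhds 0) :=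
    tendsto_lipNorm_sub hα1 hur hF (fun ε hε => ⟨C ε, hC0 ε hε, fun n z hz => (huK n).2 ε hε z hz⟩)
      hFg hulim
  have hdir : ∀ n, ∫ z in uDisc, ‖deriv (u n - F) z‖ ^ 2 ≤ s n := fun n =>
    (setIntegral_sq_le_of_tendsto (g := fun m => deriv (u n - u m))
      (fun m => ((hKD _ (huK n)).sub (hKD _ (huK m))).2) (eventually_atTop.2 ⟨n, hus n⟩)
      (continuousOn_deriv_uDisc ((hur n).sub hF).1) fun z hz => by
        have h1 := (tendsto_deriv_of_tendstoUniformlyOn hur hulim hz).const_sub (deriv (u n) z)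
        have h2 : deriv (u n - F) z = deriv (u n) z - deriv F z :=
          ((hasDerivAt_of_uDisc (hur n).1 hz).sub (hasDerivAt_of_uDisc hF.1 hz)).deriv
        rw [h2]
        refine h1.congr fun m => ?_
        exact (((hasDerivAt_of_uDisc (hur n).1 hz).sub
          (hasDerivAt_of_uDisc (hur m).1 hz)).deriv).symm).2
  have hdir0 : Tendsto (fun n => dirInt (u n - F)) atTop (nhds 0) := by
    have h1 : Tendsto (fun n => ∫ z in uDisc, ‖deriv (u n - F) z‖ ^ 2) atTop (nhds 0) :=
      squeeze_zero (fun n => integral_nonneg fun _ => by positivity) hdir hs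
    simpa [dirInt] using h1.const_mul (1 / Real.pi)
  refine hJ.closed u F (fun n => (huK n).1) hFA ?_
  have h1 := hlip.add hdir0.sqrt
  simpa [ANorm] using h1

/-- The unimodular constant `-w / |w|` of the disc automorphism vanishing at `w`. -/
noncomputable def swapUnit (w : ℂ) : ℂ := if w = 0 then 1 else -w / ‖w‖

/-- For `f w = 0`, the function obtained from `f` by replacing one factor `z - w` by
`swapUnit w * (1 - conj w * z)`. -/
noncomputable def zeroSwap (f : ℂ → ℂ) (w : ℂ) : ℂ → ℂ :=
  swapUnit w • ((1 - ‖w‖ ^ 2 : ℂ) • dslope f w - (starRingEnd ℂ) w • f)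

theorem norm_swapUnit (w : ℂ) : ‖swapUnit w‖ = 1 := by
  unfold swapUnit
  split_ifs with h
  · simp
  · simp [h]

theorem norm_swapUnit_mul_sub_le {w z : ℂ} (hw : ‖w‖ ≤ 1) (hz : ‖z‖ ≤ 1) :
    ‖swapUnit w * (1 - (starRingEnd ℂ) w * z) - (z - w)‖ ≤ 2 * (1 - ‖w‖) := by
  unfold swapUnit
  split_ifs with h
  · subst h
    simp only [map_zero, zero_mul, sub_zero, mul_one, norm_zero]
    exact (norm_sub_le _ _).trans (by rw [norm_one]; linarith)
  · have h0 : (‖w‖ : ℂ) ≠ 0 := by simpa using h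
    have h1 : (starRingEnd ℂ) w * w = ‖w‖ ^ 2 := Complex.conj_mul' w
    have e : -w / ‖w‖ * (1 - (starRingEnd ℂ) w * z) - (z - w) =
        -((1 - ‖w‖ : ℝ) : ℂ) * (w / ‖w‖ + z) := by
      push_cast
      field_simp
      linear_combination z * h1
    rw [e, norm_mul, norm_neg, Complex.norm_real, Real.norm_of_nonneg (by linarith), mul_comm]
    refine mul_le_mul_of_nonneg_right ((norm_add_le _ _).trans ?_) (by linarith)
    have : ‖w / (‖w‖ : ℂ)‖ = 1 := by simp [h]
    linarith

theorem sq_norm_one_sub_conj_mul (w z : ℂ) :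
    ‖1 - (starRingEnd ℂ) w * z‖ ^ 2 = ‖z - w‖ ^ 2 + (1 - ‖w‖ ^ 2) * (1 - ‖z‖ ^ 2) := by
  simp only [← Complex.normSq_eq_norm_sq, Complex.normSq_apply, Complex.sub_re, Complex.sub_im,
    Complex.mul_re, Complex.mul_im, Complex.conj_re, Complex.conj_im, Complex.one_re,
    Complex.one_im]
  ring

section zeroSwap

variable {f : ℂ → ℂ} {w : ℂ}

theorem zeroSwap_eq (hfw : f w = 0) (z : ℂ) :
    zeroSwap f w z = swapUnit w * (1 - (starRingEnd ℂ) w * z) * dslope f w z := by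
  have h := sub_smul_dslope_of_zero hfw z
  have h1 : (‖w‖ : ℂ) ^ 2 = (starRingEnd ℂ) w * w := (Complex.conj_mul' w).symm
  simp only [smul_eq_mul] at h
  simp only [zeroSwap, Pi.smul_apply, Pi.sub_apply, smul_eq_mul, h1]
  conv_lhs => rw [← h]
  ring

theorem norm_sub_mul_norm_zeroSwap (hfw : f w = 0) (z : ℂ) :
    ‖z - w‖ * ‖zeroSwap f w z‖ = ‖1 - (starRingEnd ℂ) w * z‖ * ‖f z‖ := by
  rw [zeroSwap_eq hfw, ← sub_smul_dslope_of_zero hfw z]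
  simp only [norm_mul, norm_swapUnit, one_mul, smul_eq_mul]
  ring

theorem norm_mul_one_add_le_norm_zeroSwap (hfw : f w = 0) (hw : w ∈ uDisc) {z : ℂ}
    (hz : z ∈ closedBall (0 : ℂ) 1) :
    ‖f z‖ * (1 + (1 - ‖z‖) * (1 - ‖w‖) / 10) ≤ ‖zeroSwap f w z‖ := by
  have hw1 : ‖w‖ < 1 := mem_ball_zero_iff.1 hw
  have hz1 : ‖z‖ ≤ 1 := mem_closedBall_zero_iff.1 hz
  rcases eq_or_ne z w with rfl | hne
  · simp [hfw]
  have hzw : 0 < ‖z - w‖ := norm_pos_iff.2 (sub_ne_zero.2 hne)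
  set t := (1 - ‖z‖) * (1 - ‖w‖) with ht
  have hz0 := norm_nonneg z
  have hw0 := norm_nonneg w
  have ht0 : 0 ≤ t := mul_nonneg (by linarith) (by linarith)
  have ht1 : t ≤ 1 := mul_le_one₀ (by linarith) (by linarith) (by linarith)
  have h2 : ‖z - w‖ ≤ 2 := (norm_sub_le _ _).trans (by linarith)
  have h3 : t ≤ (1 - ‖w‖ ^ 2) * (1 - ‖z‖ ^ 2) := by
    rw [ht, mul_comm]
    exact mul_le_mul (by nlinarith) (by nlinarith) (by linarith) (by nlinarith)
  have h4 : ‖z - w‖ * (1 + t / 10) ≤ ‖1 - (starRingEnd ℂ) w * z‖ := by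
    refine le_of_sq_le_sq ?_ (norm_nonneg _)
    rw [sq_norm_one_sub_conj_mul]
    have h5 : ‖z - w‖ ^ 2 ≤ 4 := by nlinarith
    have h6 : (1 + t / 10) ^ 2 ≤ 1 + t / 4 := by nlinarith
    rw [mul_pow]
    nlinarith [mul_le_mul_of_nonneg_left h6 (sq_nonneg ‖z - w‖)]
  refine le_of_mul_le_mul_left ?_ hzw
  rw [norm_sub_mul_norm_zeroSwap hfw]
  nlinarith [mul_le_mul_of_nonneg_right h4 (norm_nonneg (f z))]

theorem norm_le_norm_zeroSwap (hfw : f w = 0) (hw : w ∈ uDisc) {z : ℂ}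
    (hz : z ∈ closedBall (0 : ℂ) 1) : ‖f z‖ ≤ ‖zeroSwap f w z‖ := by
  refine le_trans ?_ (norm_mul_one_add_le_norm_zeroSwap hfw hw hz)
  have hw1 : ‖w‖ < 1 := mem_ball_zero_iff.1 hw
  have hz1 : ‖z‖ ≤ 1 := mem_closedBall_zero_iff.1 hz
  have : 0 ≤ (1 - ‖z‖) * (1 - ‖w‖) := mul_nonneg (by linarith) (by linarith)
  exact le_mul_of_one_le_right (norm_nonneg _) (by linarith)

theorem norm_zeroSwap_of_mem_sphere (hfw : f w = 0) (hw : w ∈ uDisc) {z : ℂ}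
    (hz : z ∈ sphere (0 : ℂ) 1) : ‖zeroSwap f w z‖ = ‖f z‖ := by
  have hw1 : ‖w‖ < 1 := mem_ball_zero_iff.1 hw
  have hz1 : ‖z‖ = 1 := mem_sphere_zero_iff_norm.1 hz
  have hne : z ≠ w := by rintro rfl; linarith
  have hzw : ‖z - w‖ ≠ 0 := norm_ne_zero_iff.2 (sub_ne_zero.2 hne)
  have h1 : ‖1 - (starRingEnd ℂ) w * z‖ = ‖z - w‖ := by
    have := sq_norm_one_sub_conj_mul w z
    rw [hz1] at this
    exact (sq_eq_sq₀ (norm_nonneg _) (norm_nonneg _)).1 (by linarith)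
  have h2 := norm_sub_mul_norm_zeroSwap hfw z
  rw [h1] at h2
  exact mul_left_cancel₀ hzw h2

theorem norm_zeroSwap_sub_mul_le (hfw : f w = 0) (hw : w ∈ uDisc) {z : ℂ} (hz : z ∈ uDisc) :
    ‖zeroSwap f w z - f z‖ * (1 - ‖z‖) ≤ 2 * (1 - ‖w‖) * ‖zeroSwap f w z‖ := by
  have hw1 : ‖w‖ < 1 := mem_ball_zero_iff.1 hw
  have hz1 : ‖z‖ < 1 := mem_ball_zero_iff.1 hz
  have h1 : 1 - ‖z‖ ≤ ‖1 - (starRingEnd ℂ) w * z‖ := by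
    have h := norm_sub_norm_le 1 ((starRingEnd ℂ) w * z)
    rw [norm_one, norm_mul, RCLike.norm_conj] at h
    nlinarith [norm_nonneg z]
  have h2 : zeroSwap f w z - f z =
      (swapUnit w * (1 - (starRingEnd ℂ) w * z) - (z - w)) * dslope f w z := by
    conv_lhs => rw [zeroSwap_eq hfw, ← sub_smul_dslope_of_zero hfw z]
    rw [smul_eq_mul]; ring
  have h3 : ‖zeroSwap f w z‖ = ‖1 - (starRingEnd ℂ) w * z‖ * ‖dslope f w z‖ := by
    rw [zeroSwap_eq hfw, norm_mul, norm_mul, norm_swapUnit, one_mul]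
  rw [h2, norm_mul, h3]
  have h4 := norm_swapUnit_mul_sub_le hw1.le hz1.le
  have h5 := mul_le_mul h4 (mul_le_mul_of_nonneg_right h1 (norm_nonneg (dslope f w z)))
    (mul_nonneg (by linarith) (norm_nonneg _)) (by linarith)
  linarith

end zeroSwap

/-- A function dominated by `g` near `v` vanishes at `v` at least as much as `g`. -/
theorem analyticOrderAt_le_of_norm_le {f g : ℂ → ℂ} {v : ℂ} (hf : AnalyticAt ℂ f v)
    (hg : AnalyticAt ℂ g v) (h : ∀ᶠ z in nhds v, ‖f z‖ ≤ ‖g z‖) :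
    analyticOrderAt g v ≤ analyticOrderAt f v := by
  by_cases hft : analyticOrderAt f v = ⊤
  · simp [hft]
  obtain ⟨p, hp⟩ := ENat.ne_top_iff_exists.1 hft
  obtain ⟨u, hu, hu0, hfu⟩ := (hf.analyticOrderAt_eq_natCast).1 hp.symm
  rw [← hp]
  by_contra! hlt
  obtain ⟨k, hk, hgk⟩ := (natCast_le_analyticOrderAt (n := p + 1) hg).1
    (by push_cast; exact Order.add_one_le_of_lt hlt)
  refine hu0 (norm_le_zero_iff.1 ?_)
  have h1 : Tendsto (fun z => ‖u z‖) (nhdsWithin v {v}ᶜ) (nhds ‖u v‖) :=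
    (hu.continuousAt.norm).tendsto.mono_left nhdsWithin_le_nhds
  have h2 : Tendsto (fun z => ‖z - v‖ * ‖k z‖) (nhdsWithin v {v}ᶜ) (nhds 0) := by
    have : ContinuousAt (fun z => ‖z - v‖ * ‖k z‖) v :=
      ((continuousAt_id.sub continuousAt_const).norm).mul hk.continuousAt.norm
    have h3 := this.tendsto.mono_left (nhdsWithin_le_nhds (s := {v}ᶜ))
    simpa using h3
  refine le_of_tendsto_of_tendsto h1 h2 ?_
  filter_upwards [nhdsWithin_le_nhds h, nhdsWithin_le_nhds hfu, nhdsWithin_le_nhds hgk,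
    self_mem_nhdsWithin] with z hz hfz hgz hne
  have hzv : 0 < ‖z - v‖ ^ p := pow_pos (norm_pos_iff.2 (sub_ne_zero.2 hne)) p
  rw [hfz, hgz, smul_eq_mul, smul_eq_mul, norm_mul, norm_mul, norm_pow, norm_pow, pow_succ,
    mul_assoc] at hz
  exact le_of_mul_le_mul_left hz hzv

theorem IsClosedIdeal.zeroSwap_mem {α : ℝ} (hα0 : 0 < α) (hα1 : α ≤ 1 / 2) {J : Set (ℂ → ℂ)}
    (hJ : IsClosedIdeal α J) {f g : ℂ → ℂ} (hf : f ∈ J) (hg : g ∈ J) {w : ℂ} (hw : w ∈ uDisc)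
    (hlt : analyticOrderAt g w < analyticOrderAt f w) : zeroSwap f w ∈ J := by
  rw [zeroSwap, sub_eq_add_neg, ← neg_smul]
  exact hJ.smul_mem _ _ (hJ.add_mem _ (hJ.smul_mem _ _ (hJ.dslope_mem hα0 hα1 hf hg hw hlt)) _
    (hJ.smul_mem _ _ hf))

/-- Iterated zero swaps inside a closed ideal converge, along a sequence of zeros that tends to
the circle, to an element of the ideal dominating all the iterates. -/
theorem IsClosedIdeal.exists_dominating {α : ℝ} (hα0 : 0 < α) (hα1 : α ≤ 1 / 2)
    {J : Set (ℂ → ℂ)} (hJ : IsClosedIdeal α J) {F : ℕ → ℂ → ℂ} {w : ℕ → ℂ} (hF : ∀ n, F n ∈ J)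
    (hw : ∀ n, w n ∈ uDisc) (hFw : ∀ n, F n (w n) = 0)
    (hs : ∀ n, F (n + 1) = zeroSwap (F n) (w n)) (hne : ∃ z ∈ uDisc, F 0 z ≠ 0) :
    ∃ G ∈ J, (∀ n, ∀ z ∈ uDisc, ‖F n z‖ ≤ ‖G z‖) ∧
      Tendsto (fun n => 1 - ‖w n‖) atTop (nhds 0) := by
  have hr : ∀ n, IsDiscReg (F n) := fun n => (hJ.mem_A _ (hF n)).2.1
  have hmono : ∀ z ∈ closedBall (0 : ℂ) 1, Monotone fun n => ‖F n z‖ := fun z hz =>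
    monotone_nat_of_le_succ fun n => by
      rw [hs n]
      exact norm_le_norm_zeroSwap (hFw n) (hw n) hz
  have hsph : ∀ n, ∀ z ∈ sphere (0 : ℂ) 1, ‖F n z‖ = ‖F 0 z‖ := fun n z hz => by
    induction n with
    | zero => rfl
    | succ n ih => rw [hs n, norm_zeroSwap_of_mem_sphere (hFw n) (hw n) hz, ih]
  obtain ⟨M, hM0, hM⟩ := (hr 0).exists_bound
  have hFM : ∀ n, ∀ z ∈ closedBall (0 : ℂ) 1, ‖F n z‖ ≤ M := fun n z hz => by
    refine Complex.norm_le_of_forall_mem_frontier_norm_le isBounded_ball (hr n).diffContOnCl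
      (fun u hu => ?_) (by rwa [closure_ball _ one_ne_zero])
    rw [frontier_ball _ one_ne_zero] at hu
    exact (hsph n u hu).trans_le (hM u (sphere_subset_closedBall hu))
  have hd0 : ∀ n, 0 ≤ 1 - ‖w n‖ := fun n => sub_nonneg.2 (mem_ball_zero_iff.1 (hw n)).le
  have hsum : Summable fun n => 1 - ‖w n‖ := by
    obtain ⟨z, hz, hFz⟩ := hne
    have hzc : z ∈ closedBall (0 : ℂ) 1 := ball_subset_closedBall hz
    have hc : 0 < ‖F 0 z‖ * ((1 - ‖z‖) / 10) :=
      mul_pos (norm_pos_iff.2 hFz) (div_pos (sub_pos.2 (mem_ball_zero_iff.1 hz)) (by norm_num))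
    refine summable_of_sum_range_le (c := M / (‖F 0 z‖ * ((1 - ‖z‖) / 10))) hd0 fun n => ?_
    rw [le_div_iff₀ hc, Finset.sum_mul]
    refine le_trans (Finset.sum_le_sum (g := fun k => ‖F (k + 1) z‖ - ‖F k z‖) fun k _ => ?_) ?_
    · have h1 := norm_mul_one_add_le_norm_zeroSwap (hFw k) (hw k) hzc
      rw [← hs k] at h1
      have h2 : ‖F 0 z‖ * ((1 - ‖z‖) / 10 * (1 - ‖w k‖)) ≤
          ‖F k z‖ * ((1 - ‖z‖) / 10 * (1 - ‖w k‖)) :=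
        mul_le_mul_of_nonneg_right (hmono z hzc k.zero_le)
          (mul_nonneg (div_nonneg (sub_pos.2 (mem_ball_zero_iff.1 hz)).le (by norm_num)) (hd0 k))
      linarith
    · rw [Finset.sum_range_sub fun k => ‖F k z‖]
      linarith [hFM n z hzc, norm_nonneg (F 0 z)]
  have hgrow : ∀ ε > 0, ∃ C, 0 ≤ C ∧
      ∀ n, ∀ z ∈ uDisc, ‖deriv (F n) z‖ ≤ ε * (1 - ‖z‖) ^ (α - 1) + C := fun ε hε => by
    obtain ⟨C, hC, h⟩ :=
      exists_deriv_growth_of_littleLip hα0 hα1 (hr 0) (hJ.mem_A _ (hF 0)).2.2 hε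
    exact ⟨C, hC, fun n => h (F n) (hr n)
      (fun z hz => hmono z (ball_subset_closedBall hz) n.zero_le) fun z hz => (hsph n z hz).le⟩
  have hD : ∀ n, ∫ z in uDisc, ‖deriv (F n) z‖ ^ 2 ≤ ∫ z in uDisc, ‖deriv (F 0) z‖ ^ 2 :=
    fun n => by
      induction n with
      | zero => exact le_rfl
      | succ n ih =>
        rw [hs n]
        exact ((hJ.mem_A _ (hF n)).setIntegral_swap_le hα0 hα1 (hw n) (hFw n)
          (norm_swapUnit _)).trans ih
  have hcauchy : UniformCauchySeqOn F atTop (closedBall 0 1) := by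
    refine Metric.uniformCauchySeqOn_iff.2 fun ε hε => ?_
    have hα2 : 0 < 2 / α + 1 := by positivity
    obtain ⟨C, hC0, hC⟩ := hgrow (ε / (8 * (2 / α + 1))) (by positivity)
    obtain ⟨t, ht0, ht1, htC⟩ : ∃ t : ℝ, 0 < t ∧ t ≤ 1 ∧ 3 * C * t ≤ ε / 8 := by
      refine ⟨min 1 (ε / (24 * (C + 1))), by positivity, min_le_left _ _, ?_⟩
      refine (mul_le_mul_of_nonneg_left (min_le_right _ _) (by positivity)).trans ?_
      rw [mul_div_assoc', div_le_div_iff₀ (by positivity) (by norm_num)]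
      nlinarith
    have hdil : ∀ n, ∀ z ∈ closedBall (0 : ℂ) 1,
        dist (F n z) (F n ((1 - t : ℝ) * z)) ≤ ε / 4 ∧ ‖((1 - t : ℝ) : ℂ) * z‖ ≤ 1 - t :=
      fun n z hz => by
        have hz1 : ‖z‖ ≤ 1 := mem_closedBall_zero_iff.1 hz
        have h0 : ‖((1 - t : ℝ) : ℂ) * z‖ ≤ 1 - t := by
          rw [norm_mul, Complex.norm_real, Real.norm_of_nonneg (by linarith)]
          exact mul_le_of_le_one_right (by linarith) hz1
        have h1 : ‖z - ((1 - t : ℝ) : ℂ) * z‖ ≤ t := by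
          have : z - ((1 - t : ℝ) : ℂ) * z = (t : ℂ) * z := by push_cast; ring
          rw [this, norm_mul, Complex.norm_real, Real.norm_of_nonneg ht0.le]
          exact mul_le_of_le_one_right ht0.le hz1
        refine ⟨?_, h0⟩
        have h2 := norm_sub_le_of_deriv_growth hα0 (by linarith) (by positivity) hC0 (hr n) (hC n)
          hz (mem_closedBall_zero_iff.2 (h0.trans (by linarith))) (h1.trans ht1)
        rw [dist_eq_norm]
        have h3 : ‖z - ((1 - t : ℝ) : ℂ) * z‖ ^ α ≤ 1 :=
          Real.rpow_le_one (norm_nonneg _) (h1.trans ht1) hα0.le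
        have h4 : ε / (8 * (2 / α + 1)) * (2 / α + 1) = ε / 8 := by field_simp
        rw [h4] at h2
        have h5 := mul_le_mul_of_nonneg_left h3 (by positivity : 0 ≤ ε / 8)
        have h6 := mul_le_mul_of_nonneg_left h1 (by positivity : 0 ≤ 3 * C)
        linarith
    obtain ⟨N, hN⟩ := Metric.cauchySeq_iff.1
      ((hsum.mul_right (2 * M / t)).hasSum.tendsto_sum_nat.cauchySeq) (ε / 2) (by positivity)
    have key : ∀ m ≥ N, ∀ n ≥ m, ∀ z ∈ closedBall (0 : ℂ) 1, dist (F m z) (F n z) < ε := by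
      intro m hm n hn z hz
      have hu := (hdil 0 z hz).2
      set u := ((1 - t : ℝ) : ℂ) * z with hu_def
      have hud : u ∈ uDisc := mem_ball_zero_iff.2 (hu.trans_lt (by linarith))
      have h1 : dist (F m u) (F n u) ≤ ∑ k ∈ Finset.Ico m n, (1 - ‖w k‖) * (2 * M / t) := by
        refine dist_le_Ico_sum_of_dist_le (f := fun k => F k u) hn fun {k} _ _ => ?_
        have h2 := norm_zeroSwap_sub_mul_le (hFw k) (hw k) hud
        rw [← hs k] at h2
        rw [dist_comm, dist_eq_norm, mul_div_assoc', le_div_iff₀ ht0]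
        have h3 := mul_le_mul_of_nonneg_left (by linarith : t ≤ 1 - ‖u‖)
          (norm_nonneg (F (k + 1) u - F k u))
        have h4 := mul_le_mul_of_nonneg_left (hFM (k + 1) u (ball_subset_closedBall hud))
          (mul_nonneg zero_le_two (hd0 k))
        linarith
      have h5 := hN n (hm.trans hn) m hm
      rw [Real.dist_eq, ← Finset.sum_Ico_eq_sub _ hn] at h5
      have h6 := (le_abs_self _).trans_lt h5
      have h7 := (hdil n z hz).1
      rw [dist_comm] at h7
      have h8 := dist_triangle4 (F m z) (F m u) (F n u) (F n z)
      linarith [(hdil m z hz).1]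
    refine ⟨N, fun m hm n hn z hz => ?_⟩
    rcases le_total m n with h | h
    · exact key m hm n h z hz
    · rw [dist_comm]
      exact key n hn m h z hz
  have hlim : ∀ z ∈ closedBall (0 : ℂ) 1, ∃ y, Tendsto (fun n => F n z) atTop (nhds y) :=
    fun z hz => cauchySeq_tendsto_of_complete (hcauchy.cauchySeq hz)
  choose! G hG using hlim
  exact ⟨G, hJ.mem_of_tendstoUniformlyOn hα0 (by linarith) hF hgrow hD
      (hcauchy.tendstoUniformlyOn_of_tendsto hG),
    fun n z hz => (hmono z (ball_subset_closedBall hz)).ge_of_tendsto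
      (hG z (ball_subset_closedBall hz)).norm n,
    hsum.tendsto_atTop_zero⟩

/-- A nonzero closed ideal contains a nonzero element with the least order of vanishing at every
point of the disc. -/
theorem IsClosedIdeal.exists_forall_analyticOrderAt_le {α : ℝ} (hα0 : 0 < α) (hα1 : α ≤ 1 / 2)
    {J : Set (ℂ → ℂ)} (hJ : IsClosedIdeal α J) (hne : ∃ f ∈ J, ∃ z ∈ uDisc, f z ≠ 0) :
    ∃ f ∈ J, (∃ z ∈ uDisc, f z ≠ 0) ∧
      ∀ w ∈ uDisc, ∀ g ∈ J, analyticOrderAt f w ≤ analyticOrderAt g w := by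
  by_contra! hcon
  set E : (ℂ → ℂ) → Set ℂ := fun f =>
    {w | w ∈ uDisc ∧ ∃ g ∈ J, analyticOrderAt g w < analyticOrderAt f w} with hE
  have hzero : ∀ f, ∀ w ∈ E f, f w = 0 := by
    rintro f w ⟨_, g, _, hlt⟩
    exact apply_eq_zero_of_analyticOrderAt_ne_zero (pos_of_gt hlt).ne'
  have hchoice : ∀ f : {f // f ∈ J ∧ ∃ z ∈ uDisc, f z ≠ 0},
      ∃ w ∈ E f, ∀ v ∈ E f, 1 - ‖v‖ ≤ 2 * (1 - ‖w‖) := by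
    rintro ⟨f, hfJ, hf⟩
    obtain ⟨w, hw, g, hg, hlt⟩ := hcon f hfJ hf
    have hb : BddAbove ((fun v : ℂ => 1 - ‖v‖) '' E f) :=
      ⟨1, by rintro _ ⟨v, -, rfl⟩; simp⟩
    have hwE : w ∈ E f := ⟨hw, g, hg, hlt⟩
    have hpos : 0 < sSup ((fun v : ℂ => 1 - ‖v‖) '' E f) :=
      (sub_pos.2 (mem_ball_zero_iff.1 hw)).trans_le (le_csSup hb ⟨w, hwE, rfl⟩)
    obtain ⟨_, ⟨v, hv, rfl⟩, hlt'⟩ := exists_lt_of_lt_csSup (Set.Nonempty.image _ ⟨w, hwE⟩) (half_lt_self hpos)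
    refine ⟨v, hv, fun u hu => ?_⟩
    have := le_csSup hb ⟨u, hu, rfl⟩
    simp only at this hlt'
    linarith
  choose p hpE hp using hchoice
  have hstep : ∀ f : {f // f ∈ J ∧ ∃ z ∈ uDisc, f z ≠ 0},
      zeroSwap f (p f) ∈ J ∧ ∃ z ∈ uDisc, zeroSwap f (p f) z ≠ 0 := fun f => by
    obtain ⟨hw, g, hg, hlt⟩ := hpE f
    obtain ⟨z, hz, hfz⟩ := f.2.2
    exact ⟨hJ.zeroSwap_mem hα0 hα1 f.2.1 hg hw hlt, z, hz, norm_pos_iff.1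
      ((norm_pos_iff.2 hfz).trans_le
        (norm_le_norm_zeroSwap (hzero _ _ (hpE f)) hw (ball_subset_closedBall hz)))⟩
  obtain ⟨f₀, hf₀⟩ := hne
  let F : ℕ → {f // f ∈ J ∧ ∃ z ∈ uDisc, f z ≠ 0} := fun n =>
    Nat.rec ⟨f₀, hf₀⟩ (fun _ f => ⟨zeroSwap f (p f), hstep f⟩) n
  obtain ⟨G, hG, hFG, hlim⟩ := hJ.exists_dominating hα0 hα1 (F := fun n => (F n).1)
    (w := fun n => p (F n)) (fun n => (F n).2.1) (fun n => (hpE (F n)).1)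
    (fun n => hzero _ _ (hpE (F n))) (fun _ => rfl) (F 0).2.2
  obtain ⟨z, hz, hfz⟩ := (F 0).2.2
  obtain ⟨v, hv, g, hg, hlt⟩ := hcon G hG
    ⟨z, hz, norm_pos_iff.1 ((norm_pos_iff.2 hfz).trans_le (hFG 0 z hz))⟩
  have hv0 : 0 < (1 - ‖v‖) / 2 := half_pos (sub_pos.2 (mem_ball_zero_iff.1 hv))
  obtain ⟨n, hn⟩ := (hlim.eventually_lt_const hv0).exists
  have hvn : v ∉ E (F n).1 := fun h => by linarith [hp (F n) v h]
  refine hvn ⟨hv, g, hg, hlt.trans_le ?_⟩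
  exact analyticOrderAt_le_of_norm_le (analyticAt_of_uDisc (hJ.mem_A _ (F n).2.1).1.1 hv)
    (analyticAt_of_uDisc (hJ.mem_A _ hG).1.1 hv)
    (eventually_of_mem (isOpen_ball.mem_nhds hv) (hFG n))

/-- In a nonzero closed ideal of `𝒜_α` there exists `f` whose order
of vanishing at each point of `𝔻` is minimal among nonzero members of the ideal. -/
theorem exists_min_order_function (α : ℝ) (hα0 : 0 < α) (hα1 : α ≤ 1/2)
    (J : Set (ℂ → ℂ)) (hJ : IsClosedIdeal α J)
    (hJne : ∃ f ∈ J, ∃ z ∈ Metric.closedBall (0:ℂ) 1, f z ≠ 0) :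
    ∃ f ∈ J, (∃ z ∈ uDisc, f z ≠ 0) ∧
      ∀ w ∈ uDisc, ∀ n : ℕ,
        ((∀ k < n, iteratedDeriv k f w = 0) ↔
          ∀ g ∈ J, (∃ z ∈ uDisc, g z ≠ 0) → ∀ k < n, iteratedDeriv k g w = 0) := by
  have hne : ∃ f ∈ J, ∃ z ∈ uDisc, f z ≠ 0 := by
    obtain ⟨f, hf, z, hz, hfz⟩ := hJne
    refine ⟨f, hf, ?_⟩
    by_contra! h
    refine hfz (Set.EqOn.of_subset_closure (s := uDisc) (t := closedBall 0 1) (g := 0) h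
      (hJ.mem_A f hf).2.1.2 continuousOn_const ball_subset_closedBall ?_ hz)
    exact (closure_ball (0 : ℂ) one_ne_zero).ge
  obtain ⟨f, hf, hf0, hmin⟩ := hJ.exists_forall_analyticOrderAt_le hα0 hα1 hne
  refine ⟨f, hf, hf0, fun w hw n => ⟨fun h g hg _ => ?_, fun h => h f hf hf0⟩⟩
  have han : ∀ g ∈ J, AnalyticAt ℂ g w := fun g hg => analyticAt_of_uDisc (hJ.mem_A g hg).1.1 hw
  exact (natCast_le_analyticOrderAt_iff_iteratedDeriv_eq_zero (han g hg)).1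
    (((natCast_le_analyticOrderAt_iff_iteratedDeriv_eq_zero (han f hf)).2 h).trans (hmin w hw g hg))
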